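/- arXiv:0709.3650 — 3 statements merged into one kernel-verified Lean document; each statement's English description precedes it below -/
import Mathlib

section
/- Let T > 0, b ∈ (0,T], k ∈ ℕ, and let w be a C^∞ function on the open square Ω_T = (0,T)×(0,T). Then for every μ ∈ (0,b), ∫_μ^b (μ+ν)^{-1-k} w(μ,ν)² dν ≤ 2b μ^{-1-k} w(μ,μ)² + 2b ∫_μ^b (μ+ν)^{-k} (∂_ν w(μ,ν))² dν (where both sides are allowed to be +∞). -/
open MeasureTheory Set

/-- Cauchy-Schwarz against the constant function one on an interval. -/
theorem sq_intervalIntegral_le {a b : ℝ} (hab : a < b) {g : ℝ → ℝ}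
    (hg : ContinuousOn g (uIcc a b)) :
    (∫ s in a..b, g s) ^ 2 ≤ (b - a) * ∫ s in a..b, g s ^ 2 := by
  have hL : 0 < b - a := sub_pos.2 hab
  set A := ∫ s in a..b, g s with hA
  have hg1 : IntervalIntegrable g volume a b := hg.intervalIntegrable
  have hg2 : IntervalIntegrable (fun s => g s ^ 2) volume a b := (hg.pow 2).intervalIntegrable
  have h0 : 0 ≤ ∫ s in a..b, ((b - a) * g s - A) ^ 2 :=
    intervalIntegral.integral_nonneg hab.le fun _ _ => sq_nonneg _
  have h1 : ∫ s in a..b, ((b - a) * g s - A) ^ 2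
      = (b - a) ^ 2 * (∫ s in a..b, g s ^ 2) - 2 * (b - a) * A * A + (b - a) * A ^ 2 := by
    have e : ∀ s, ((b - a) * g s - A) ^ 2
        = (b - a) ^ 2 * g s ^ 2 - 2 * (b - a) * A * g s + A ^ 2 := fun s => by ring
    simp_rw [e]
    rw [intervalIntegral.integral_add ((hg2.const_mul _).sub (hg1.const_mul _))
        intervalIntegrable_const,
      intervalIntegral.integral_sub (hg2.const_mul _) (hg1.const_mul _),
      intervalIntegral.integral_const_mul, intervalIntegral.integral_const_mul,
      intervalIntegral.integral_const, smul_eq_mul, ← hA]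
  rw [h1] at h0
  have h2 : 0 ≤ (b - a) * ((b - a) * (∫ s in a..b, g s ^ 2) - A ^ 2) := by linarith
  linarith [nonneg_of_mul_nonneg_right h2 hL]

/-- A weighted pointwise bound for a continuously differentiable function by its value at the
left endpoint and the weighted Dirichlet energy. -/
theorem rpow_mul_sq_le_add_integral {μ ν : ℝ} (hμ : 0 < μ) (hν : μ < ν) (k : ℕ) {f : ℝ → ℝ}
    (hf : ∀ s ∈ uIcc μ ν, DifferentiableAt ℝ f s) (hf' : ContinuousOn (deriv f) (uIcc μ ν)) :
    (μ + ν) ^ (-1 - (k : ℝ)) * f ν ^ 2 ≤ 2 * (μ ^ (-1 - (k : ℝ)) * f μ ^ 2) +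
      2 * ∫ s in μ..ν, (μ + s) ^ (-(k : ℝ)) * deriv f s ^ 2 := by
  have hpos : 0 < μ + ν := by linarith
  have hftc : ∫ s in μ..ν, deriv f s = f ν - f μ :=
    intervalIntegral.integral_deriv_eq_sub hf hf'.intervalIntegrable
  have hcs := sq_intervalIntegral_le hν hf'
  rw [hftc] at hcs
  have hsq : f ν ^ 2 ≤ 2 * f μ ^ 2 + 2 * ((ν - μ) * ∫ s in μ..ν, deriv f s ^ 2) := by
    nlinarith [sq_nonneg (f ν - 2 * f μ)]
  have hI : 0 ≤ ∫ s in μ..ν, deriv f s ^ 2 :=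
    intervalIntegral.integral_nonneg hν.le fun _ _ => sq_nonneg _
  have hw1 : (μ + ν) ^ (-1 - (k : ℝ)) ≤ μ ^ (-1 - (k : ℝ)) :=
    Real.rpow_le_rpow_of_nonpos hμ (by linarith)
      (by linarith [(Nat.cast_nonneg k : (0 : ℝ) ≤ k)])
  have hw2 : (μ + ν) ^ (-1 - (k : ℝ)) * (ν - μ) ≤ (μ + ν) ^ (-(k : ℝ)) := by
    have e : (μ + ν) ^ (-(k : ℝ)) = (μ + ν) ^ (-1 - (k : ℝ)) * (μ + ν) := by
      rw [← Real.rpow_add_one hpos.ne']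
      congr 1
      ring
    rw [e]
    exact mul_le_mul_of_nonneg_left (by linarith) (Real.rpow_nonneg hpos.le _)
  have hcont : ContinuousOn (fun s => (μ + s) ^ (-(k : ℝ)) * deriv f s ^ 2) (uIcc μ ν) := by
    refine ContinuousOn.mul (ContinuousOn.rpow_const (by fun_prop) fun s hs => Or.inl ?_)
      (hf'.pow 2)
    rw [uIcc_of_le hν.le] at hs
    linarith [hs.1]
  have hmono : (μ + ν) ^ (-(k : ℝ)) * ∫ s in μ..ν, deriv f s ^ 2
      ≤ ∫ s in μ..ν, (μ + s) ^ (-(k : ℝ)) * deriv f s ^ 2 := by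
    rw [← intervalIntegral.integral_const_mul]
    refine intervalIntegral.integral_mono_on hν.le
      ((hf'.pow 2).intervalIntegrable.const_mul _) hcont.intervalIntegrable fun s hs => ?_
    exact mul_le_mul_of_nonneg_right
      (Real.rpow_le_rpow_of_nonpos (by linarith [hs.1]) (by linarith [hs.2])
        (neg_nonpos.2 (Nat.cast_nonneg k))) (sq_nonneg _)
  calc (μ + ν) ^ (-1 - (k : ℝ)) * f ν ^ 2
      ≤ (μ + ν) ^ (-1 - (k : ℝ)) *
          (2 * f μ ^ 2 + 2 * ((ν - μ) * ∫ s in μ..ν, deriv f s ^ 2)) :=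
        mul_le_mul_of_nonneg_left hsq (Real.rpow_nonneg hpos.le _)
    _ = 2 * ((μ + ν) ^ (-1 - (k : ℝ)) * f μ ^ 2) +
          2 * ((μ + ν) ^ (-1 - (k : ℝ)) * (ν - μ) * ∫ s in μ..ν, deriv f s ^ 2) := by ring
    _ ≤ _ := by
        have h1 := mul_le_mul_of_nonneg_right hw1 (sq_nonneg (f μ))
        have h2 := mul_le_mul_of_nonneg_right hw2 hI
        linarith

/-- The weighted pointwise bound, with the energy taken over a larger interval and valued in
`[0,∞]`. -/
theorem ofReal_rpow_mul_sq_le_add_lintegral {μ ν b : ℝ} (hμ : 0 < μ) (hν : ν ∈ Ioo μ b) (k : ℕ)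
    {f : ℝ → ℝ} (hf : ∀ s ∈ uIcc μ ν, DifferentiableAt ℝ f s)
    (hf' : ContinuousOn (deriv f) (uIcc μ ν)) :
    ENNReal.ofReal ((μ + ν) ^ (-1 - (k : ℝ)) * f ν ^ 2)
      ≤ ENNReal.ofReal (2 * (μ ^ (-1 - (k : ℝ)) * f μ ^ 2)) +
        2 * ∫⁻ s in Ioo μ b, ENNReal.ofReal ((μ + s) ^ (-(k : ℝ)) * deriv f s ^ 2) := by
  have hcont : ContinuousOn (fun s => (μ + s) ^ (-(k : ℝ)) * deriv f s ^ 2) (uIcc μ ν) := by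
    refine ContinuousOn.mul (ContinuousOn.rpow_const (by fun_prop) fun s hs => Or.inl ?_)
      (hf'.pow 2)
    rw [uIcc_of_le hν.1.le] at hs
    linarith [hs.1]
  have hint : ENNReal.ofReal (∫ s in μ..ν, (μ + s) ^ (-(k : ℝ)) * deriv f s ^ 2)
      ≤ ∫⁻ s in Ioo μ b, ENNReal.ofReal ((μ + s) ^ (-(k : ℝ)) * deriv f s ^ 2) := by
    rw [intervalIntegral.integral_of_le hν.1.le,
      ofReal_integral_eq_lintegral_ofReal
        ((intervalIntegrable_iff_integrableOn_Ioc_of_le hν.1.le).1 hcont.intervalIntegrable)]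
    · exact lintegral_mono_set fun s hs => ⟨hs.1, hs.2.trans_lt hν.2⟩
    · filter_upwards [ae_restrict_mem measurableSet_Ioc] with s hs
      exact mul_nonneg (Real.rpow_nonneg (by linarith [hs.1]) _) (sq_nonneg _)
  refine (ENNReal.ofReal_le_ofReal
    (rpow_mul_sq_le_add_integral hμ hν.1 k hf hf')).trans ?_
  refine ENNReal.ofReal_add_le.trans (add_le_add le_rfl ?_)
  rw [ENNReal.ofReal_mul zero_le_two, ENNReal.ofReal_ofNat]
  exact mul_le_mul_right hint 2

/-- For `w` smooth on the open square `(0,T)×(0,T)`, `b ∈ (0,T]`, `k ∈ ℕ`,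
and `μ ∈ (0,b)`:
`∫_μ^b (μ+ν)^{-1-k} w(μ,ν)² dν ≤ 2b μ^{-1-k} w(μ,μ)² + 2b ∫_μ^b (μ+ν)^{-k} (∂_ν w(μ,ν))² dν`,
where all integrals are taken in `[0,∞]`. -/
theorem stmt0 (T : ℝ) (hT : 0 < T) (b : ℝ) (hb : 0 < b) (hbT : b ≤ T) (k : ℕ)
    (w : ℝ → ℝ → ℝ)
    (hw : ContDiffOn ℝ (⊤ : ℕ∞) (fun p : ℝ × ℝ => w p.1 p.2) (Ioo 0 T ×ˢ Ioo 0 T))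
    (μ : ℝ) (hμ : μ ∈ Ioo (0 : ℝ) b) :
    (∫⁻ ν in Ioo μ b, ENNReal.ofReal ((μ + ν) ^ (-1 - (k : ℝ)) * (w μ ν) ^ 2))
      ≤ ENNReal.ofReal (2 * b * μ ^ (-1 - (k : ℝ)) * (w μ μ) ^ 2)
        + ENNReal.ofReal (2 * b) *
          ∫⁻ ν in Ioo μ b, ENNReal.ofReal ((μ + ν) ^ (-(k : ℝ)) * (deriv (w μ) ν) ^ 2) := by
  have hsm : ContDiffOn ℝ (⊤ : ℕ∞) (w μ) (Ioo 0 T) :=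
    hw.comp (f := fun s : ℝ => (μ, s)) (by fun_prop)
      fun s hs => ⟨⟨hμ.1, hμ.2.trans_le hbT⟩, hs⟩
  have hdiff : DifferentiableOn ℝ (w μ) (Ioo 0 T) := hsm.differentiableOn (by simp)
  have hder : ContinuousOn (deriv (w μ)) (Ioo 0 T) :=
    hsm.continuousOn_deriv_of_isOpen isOpen_Ioo (by exact_mod_cast le_top)
  have hpt : ∀ ν ∈ Ioo μ b, ENNReal.ofReal ((μ + ν) ^ (-1 - (k : ℝ)) * (w μ ν) ^ 2)
      ≤ ENNReal.ofReal (2 * (μ ^ (-1 - (k : ℝ)) * (w μ μ) ^ 2)) +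
        2 * ∫⁻ s in Ioo μ b, ENNReal.ofReal ((μ + s) ^ (-(k : ℝ)) * deriv (w μ) s ^ 2) := by
    intro ν hν
    have hsub : uIcc μ ν ⊆ Ioo 0 T := by
      rw [uIcc_of_le hν.1.le]
      exact fun s hs => ⟨hμ.1.trans_le hs.1, hs.2.trans_lt (hν.2.trans_le hbT)⟩
    exact ofReal_rpow_mul_sq_le_add_lintegral hμ.1 hν k
      (fun s hs => hdiff.differentiableAt (isOpen_Ioo.mem_nhds (hsub hs))) (hder.mono hsub)
  refine (setLIntegral_mono measurable_const hpt).trans ?_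
  rw [setLIntegral_const, Real.volume_Ioo]
  refine (mul_le_mul_right (ENNReal.ofReal_le_ofReal (sub_le_self b hμ.1.le)) _).trans ?_
  rw [add_mul, ← ENNReal.ofReal_mul (mul_nonneg zero_le_two
    (mul_nonneg (Real.rpow_nonneg hμ.1.le _) (sq_nonneg _)))]
  refine add_le_add (ENNReal.ofReal_le_ofReal (le_of_eq (by ring))) (le_of_eq ?_)
  rw [ENNReal.ofReal_mul zero_le_two, ENNReal.ofReal_ofNat]
  ring
end

section
/- Let ε > 0 and let B₁ be a C^∞ function on [0,ε). There exists T₀ ∈ (0, ε/2] with the following property. Let 0 < T ≤ T₀ and let w be a C^∞ function on the open square Ω_T = (0,T)×(0,T) satisfying (μ+ν)² ∂_μ∂_ν w(μ,ν) = (2μν/(μ+ν)) B₁(2μν/(μ+ν)) w(μ,ν) on Ω_T, whose diagonal traces q₁(μ) = w(μ,μ) and q₂(μ) = (∂_μ w)(μ,μ) extend to C^∞ functions on [0,T] all of whose derivatives vanish at μ = 0. Then w extends to a C^∞ function on the closed square [0,T]×[0,T]. -/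
open MeasureTheory Set

/-- The bound for the reflection weights. -/
noncomputable def reflectionBound (k : ℕ) : ℝ :=
  Real.exp 1 * ∏ m ∈ Finset.range k, (1 / 4 : ℝ) ^ m

lemma summable_reflectionBound (n : ℕ) :
    Summable fun k : ℕ => reflectionBound k * ((4 : ℝ) ^ k) ^ n := by
  refine summable_of_ratio_norm_eventually_le (r := 1 / 4) (by norm_num) ?_
  filter_upwards [Filter.eventually_ge_atTop (n + 1)] with k hk
  have hp : 0 ≤ ∏ m ∈ Finset.range k, (1 / 4 : ℝ) ^ m :=
    Finset.prod_nonneg fun _ _ => by positivity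
  have h4 : (1 / 4 : ℝ) ^ k * 4 ^ n ≤ 1 / 4 := by
    obtain ⟨d, rfl⟩ := Nat.exists_eq_add_of_le hk
    have h1 : (1 / 4 : ℝ) ^ d ≤ 1 := pow_le_one₀ (by norm_num) (by norm_num)
    have h2 : (1 / 4 : ℝ) ^ n * 4 ^ n = 1 := by rw [← mul_pow]; norm_num
    have h3 : (1 / 4 : ℝ) ^ (n + 1 + d) * 4 ^ n
        = ((1 / 4 : ℝ) ^ n * 4 ^ n) * ((1 / 4) * (1 / 4 : ℝ) ^ d) := by ring
    rw [h3, h2]; linarith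
  unfold reflectionBound
  rw [Real.norm_of_nonneg (mul_nonneg (mul_nonneg (Real.exp_pos _).le
      (Finset.prod_nonneg fun _ _ => by positivity)) (by positivity)),
    Real.norm_of_nonneg (mul_nonneg (mul_nonneg (Real.exp_pos _).le hp) (by positivity)),
    Finset.prod_range_succ]
  calc _ = ((1 / 4 : ℝ) ^ k * 4 ^ n) *
        (Real.exp 1 * (∏ m ∈ Finset.range k, (1 / 4 : ℝ) ^ m) * (4 ^ k) ^ n) := by
          rw [pow_succ (4 : ℝ) k, mul_pow]; ring
    _ ≤ _ := by gcongr

lemma abs_lagrange_basis_le (k M : ℕ) :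
    |∏ j ∈ (Finset.range (k + 1 + M)).erase k,
      ((-(4 : ℝ) ^ k - -(4 : ℝ) ^ j)⁻¹ * (1 - -(4 : ℝ) ^ j))| ≤ reflectionBound k := by
  set f : ℕ → ℝ := fun j => |(-(4 : ℝ) ^ k - -(4 : ℝ) ^ j)⁻¹ * (1 - -(4 : ℝ) ^ j)| with hf
  have hlow : ∀ j ∈ Finset.range k, f j ≤ (1 / 4 : ℝ) ^ (k - 1 - j) := by
    intro j hj
    obtain ⟨d, rfl⟩ := Nat.exists_eq_add_of_lt (Finset.mem_range.1 hj)
    have e : j + d + 1 - 1 - j = d := by omega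
    have h4 : (1 : ℝ) ≤ 4 ^ j := one_le_pow₀ (by norm_num)
    have hd : (1 : ℝ) ≤ 4 ^ d := one_le_pow₀ (by norm_num)
    have hneg : -(4 : ℝ) ^ (j + d + 1) - -(4 : ℝ) ^ j = -(4 ^ j * (4 * 4 ^ d - 1)) := by ring
    have hpos : (0 : ℝ) < 4 ^ j * (4 * 4 ^ d - 1) := by apply mul_pos <;> linarith
    simp only [hf]
    rw [e, hneg, abs_mul, abs_inv, abs_neg, abs_of_pos hpos, abs_of_pos (by linarith),
      inv_mul_le_iff₀ hpos, one_div, inv_pow]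
    generalize (4 : ℝ) ^ j = a at *
    generalize (4 : ℝ) ^ d = b at *
    have hb : b * b⁻¹ = 1 := mul_inv_cancel₀ (by linarith)
    have hb1 : b⁻¹ ≤ 1 := inv_le_one_of_one_le₀ hd
    have : a * (4 * b - 1) * b⁻¹ = a * (4 * (b * b⁻¹) - b⁻¹) := by ring
    rw [this, hb]
    nlinarith
  have hhigh : ∀ i ∈ Finset.range M, f (k + 1 + i) ≤ Real.exp (2 / 3 * (1 / 4 : ℝ) ^ i) := by
    intro i _
    refine le_trans ?_ (Real.add_one_le_exp _)
    have h4 : (1 : ℝ) ≤ 4 ^ k := one_le_pow₀ (by norm_num)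
    have hd : (1 : ℝ) ≤ 4 ^ i := one_le_pow₀ (by norm_num)
    have hneg : -(4 : ℝ) ^ k - -(4 : ℝ) ^ (k + 1 + i) = 4 ^ k * (4 * 4 ^ i - 1) := by ring
    have hpos : (0 : ℝ) < 4 ^ k * (4 * 4 ^ i - 1) := by apply mul_pos <;> linarith
    simp only [hf]
    rw [hneg, abs_mul, abs_inv, abs_of_pos hpos, abs_of_pos (by
      have : (0 : ℝ) < 4 ^ (k + 1 + i) := by positivity
      linarith), inv_mul_le_iff₀ hpos]
    have e : (4 : ℝ) ^ (k + 1 + i) = 4 ^ k * (4 * 4 ^ i) := by ring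
    have e2 : (1 / 4 : ℝ) ^ i = (4 ^ i)⁻¹ := by rw [one_div, inv_pow]
    rw [e, e2]
    generalize (4 : ℝ) ^ k = a at *
    generalize (4 : ℝ) ^ i = b at *
    have hb : b * b⁻¹ = 1 := mul_inv_cancel₀ (by linarith)
    have hb1 : b⁻¹ ≤ 1 := inv_le_one_of_one_le₀ hd
    have : a * (4 * b - 1) * (2 / 3 * b⁻¹ + 1)
        = a * (8 / 3 * (b * b⁻¹) - 2 / 3 * b⁻¹ + 4 * b - 1) := by ring
    rw [this, hb]
    nlinarith
  have hnn : ∀ j, 0 ≤ f j := fun j => abs_nonneg _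
  have hsplit : |∏ j ∈ (Finset.range (k + 1 + M)).erase k,
      ((-(4 : ℝ) ^ k - -(4 : ℝ) ^ j)⁻¹ * (1 - -(4 : ℝ) ^ j))|
      = (∏ j ∈ Finset.range k, f j) * ∏ i ∈ Finset.range M, f (k + 1 + i) := by
    rw [Finset.abs_prod]
    have h1 : ∏ j ∈ (Finset.range (k + 1 + M)).erase k, f j
        = ∏ j ∈ Finset.range (k + 1 + M), if j = k then 1 else f j := by
      rw [← Finset.mul_prod_erase (Finset.range (k + 1 + M)) _
        (Finset.mem_range.2 (by omega : k < k + 1 + M))]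
      rw [if_pos rfl, one_mul]
      exact Finset.prod_congr rfl fun j hj => (if_neg (Finset.ne_of_mem_erase hj)).symm
    rw [h1, Finset.prod_range_add, Finset.prod_range_succ, if_pos rfl, mul_one]
    congr 1
    · exact Finset.prod_congr rfl fun j hj => if_neg (Finset.mem_range.1 hj).ne
    · exact Finset.prod_congr rfl fun j hj => if_neg (by omega)
  rw [hsplit, reflectionBound, mul_comm]
  have hgeo : ∑ i ∈ Finset.range M, 2 / 3 * (1 / 4 : ℝ) ^ i ≤ 1 := by
    rw [← Finset.mul_sum]
    have := geom_sum_eq (by norm_num : (1 / 4 : ℝ) ≠ 1) M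
    rw [this]
    have : (0 : ℝ) ≤ (1 / 4) ^ M := by positivity
    have e : (((1 : ℝ) / 4) ^ M - 1) / (1 / 4 - 1) = 4 / 3 * (1 - (1 / 4) ^ M) := by
      norm_num; ring
    rw [e]; linarith
  refine mul_le_mul ?_ ?_ (Finset.prod_nonneg fun j _ => hnn j) (Real.exp_pos _).le
  · refine (Finset.prod_le_prod (fun i _ => hnn _) hhigh).trans ?_
    rw [← Real.exp_sum]
    exact Real.exp_le_exp.2 hgeo
  · refine (Finset.prod_le_prod (fun i _ => hnn _) hlow).trans ?_
    rw [Finset.prod_range_reflect (fun m => (1 / 4 : ℝ) ^ m) k]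

/-- Weights for a smooth reflection across a hyperplane. -/
lemma exists_reflection_weights : ∃ a : ℕ → ℝ,
    (∀ n : ℕ, Summable fun k : ℕ => |a k| * ((4 : ℝ) ^ k) ^ n) ∧
      ∀ n : ℕ, ∑' k : ℕ, a k * (-(4 : ℝ) ^ k) ^ n = 1 := by
  classical
  set v : ℕ → ℝ := fun k => -(4 : ℝ) ^ k with hv
  set A : ℕ → ℕ → ℝ := fun N k => if k < N then
    (Lagrange.basis (Finset.range N) v k).eval 1 else 0 with hA
  have hAb : ∀ N k, |A N k| ≤ reflectionBound k := by
    intro N k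
    simp only [hA]
    split_ifs with h
    · obtain ⟨M, rfl⟩ := Nat.exists_eq_add_of_le (Nat.succ_le_of_lt h)
      have := abs_lagrange_basis_le k M
      simpa [Lagrange.basis, Lagrange.basisDivisor, Polynomial.eval_prod, hv] using this
    · rw [abs_zero]
      exact mul_nonneg (Real.exp_pos _).le (Finset.prod_nonneg fun _ _ => by positivity)
  have hinj : Function.Injective v := fun i j hij => by
    have : (4 : ℝ) ^ i = 4 ^ j := by simpa [hv] using hij
    exact pow_right_injective₀ (by norm_num) (by norm_num) this
  have hlim : ∀ k, ∃ x, |x| ≤ reflectionBound k ∧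
      Filter.Tendsto (fun N => A N k) (Filter.hyperfilter ℕ : Filter ℕ) (nhds x) := by
    intro k
    obtain ⟨x, hx, h⟩ := (isCompact_Icc (a := -reflectionBound k)
      (b := reflectionBound k)).ultrafilter_le_nhds
      ((Filter.hyperfilter ℕ).map fun N : ℕ => A N k) 
      (Filter.le_principal_iff.2 (Ultrafilter.mem_map.2
        (Filter.univ_mem' fun N : ℕ => abs_le.1 (hAb N k))))
    exact ⟨x, abs_le.2 hx, h⟩
  choose a ha hat using hlim
  refine ⟨a, fun n => ?_, fun n => ?_⟩
  · refine Summable.of_nonneg_of_le (fun k => by positivity) (fun k => ?_)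
      (summable_reflectionBound n)
    exact mul_le_mul_of_nonneg_right (ha k) (by positivity)
  · have h1 := tendsto_tsum_of_dominated_convergence
      (𝓕 := (Filter.hyperfilter ℕ : Filter ℕ))
      (f := fun N k => A N k * (v k) ^ n) (g := fun k => a k * (v k) ^ n)
      (summable_reflectionBound n) (fun k => (hat k).mul_const _)
      (Filter.Eventually.of_forall fun N k => by
        rw [norm_mul, norm_pow, Real.norm_eq_abs, Real.norm_eq_abs]
        have : |v k| = 4 ^ k := by simp [hv]
        rw [this]
        exact mul_le_mul_of_nonneg_right (hAb N k) (by positivity))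
    refine tendsto_nhds_unique h1 (Filter.Tendsto.congr' ?_ tendsto_const_nhds)
    have hge : ∀ᶠ N in (Filter.hyperfilter ℕ : Filter ℕ), n < N :=
      Nat.hyperfilter_le_atTop (Filter.eventually_gt_atTop n)
    filter_upwards [hge] with N hN
    have hinterp := Lagrange.eq_interpolate (s := Finset.range N) (v := v)
      (f := (Polynomial.X : Polynomial ℝ) ^ n) (hinj.injOn) (by
        rw [Polynomial.degree_X_pow, Finset.card_range]; exact_mod_cast hN)
    have h2 := congrArg (Polynomial.eval 1) hinterp
    rw [Lagrange.interpolate_apply, Polynomial.eval_finsetSum] at h2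
    rw [tsum_eq_sum (s := Finset.range N) (fun k hk => by
      simp only [hA]; rw [if_neg (by simpa using hk), zero_mul])]
    simp only [Polynomial.eval_pow, Polynomial.eval_X, one_pow, Polynomial.eval_mul,
      Polynomial.eval_C] at h2
    rw [h2]
    refine Finset.sum_congr rfl fun k hk => ?_
    simp only [hA]
    rw [if_pos (Finset.mem_range.1 hk), mul_comm]

/-- The covector on `ℝ × ℝ` with components `a` and `b`. -/
noncomputable def covec (a b : ℝ) : ℝ × ℝ →L[ℝ] ℝ :=
  a • ContinuousLinearMap.fst ℝ ℝ ℝ + b • ContinuousLinearMap.snd ℝ ℝ ℝ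

@[simp] lemma covec_apply (a b : ℝ) (p : ℝ × ℝ) : covec a b p = a * p.1 + b * p.2 := by
  simp [covec]

lemma norm_covec_le (a b : ℝ) : ‖covec a b‖ ≤ |a| + |b| := by
  refine ContinuousLinearMap.opNorm_le_bound _ (by positivity) fun p => ?_
  rw [covec_apply, add_mul]
  refine (abs_add_le _ _).trans ?_
  rw [abs_mul, abs_mul]
  gcongr
  · exact norm_fst_le p
  · exact norm_snd_le p

lemma continuous_covec : Continuous fun q : ℝ × ℝ => covec q.1 q.2 := by
  unfold covec; fun_prop

/-- `F i j` are the mixed partial derivatives of `F 0 0` on `S`, and all of them are bounded. -/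
structure BddFamily (S : Set (ℝ × ℝ)) (F : ℕ → ℕ → ℝ × ℝ → ℝ) : Prop where
  hasFDerivAt : ∀ i j, ∀ p ∈ S, HasFDerivAt (F i j) (covec (F (i + 1) j p) (F i (j + 1) p)) p
  bounded : ∀ i j, ∃ C, ∀ p ∈ S, |F i j p| ≤ C

namespace BddFamily

variable {S : Set (ℝ × ℝ)} {F G : ℕ → ℕ → ℝ × ℝ → ℝ}

lemma congr (h : BddFamily S F) (hS : IsOpen S) (hFG : ∀ i j, EqOn (G i j) (F i j) S) :
    BddFamily S G where
  hasFDerivAt i j p hp := by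
    rw [hFG _ _ hp, hFG _ _ hp]
    exact (h.hasFDerivAt i j p hp).congr_of_eventuallyEq ((hFG i j).eventuallyEq_of_mem
      (hS.mem_nhds hp))
  bounded i j := by
    obtain ⟨C, hC⟩ := h.bounded i j
    exact ⟨C, fun p hp => by rw [hFG _ _ hp]; exact hC p hp⟩

lemma mono (h : BddFamily S F) {S' : Set (ℝ × ℝ)} (hS : S' ⊆ S) : BddFamily S' F :=
  ⟨fun i j p hp => h.hasFDerivAt i j p (hS hp),
    fun i j => (h.bounded i j).imp fun _ hC p hp => hC p (hS hp)⟩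

lemma add (h : BddFamily S F) (h' : BddFamily S G) :
    BddFamily S fun i j p => F i j p + G i j p where
  hasFDerivAt i j p hp := by
    exact ((h.hasFDerivAt i j p hp).add (h'.hasFDerivAt i j p hp)).congr_fderiv
      (by ext <;> simp)
  bounded i j := by
    obtain ⟨C, hC⟩ := h.bounded i j
    obtain ⟨C', hC'⟩ := h'.bounded i j
    exact ⟨C + C', fun p hp => (abs_add_le _ _).trans (add_le_add (hC p hp) (hC' p hp))⟩

lemma swap (h : BddFamily S F) : BddFamily (Prod.swap ⁻¹' S) fun i j p => F j i p.swap where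
  hasFDerivAt i j p hp := by
    have := (h.hasFDerivAt j i p.swap hp).comp p
      (ContinuousLinearEquiv.prodComm ℝ ℝ ℝ).hasFDerivAt
    exact this.congr_fderiv (by ext <;> simp)
  bounded i j := (h.bounded j i).imp fun _ hC p hp => hC _ hp

lemma reflect (h : BddFamily S F) (T : ℝ) :
    BddFamily ((fun p : ℝ × ℝ => (T - p.1, p.2)) ⁻¹' S)
      fun i j p => (-1) ^ i * F i j (T - p.1, p.2) where
  hasFDerivAt i j p hp := by
    have h1 : HasFDerivAt (fun p : ℝ × ℝ => (T - p.1, p.2))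
        ((-ContinuousLinearMap.fst ℝ ℝ ℝ).prod (ContinuousLinearMap.snd ℝ ℝ ℝ)) p :=
      (hasFDerivAt_fst.const_sub T).prodMk hasFDerivAt_snd
    have := ((h.hasFDerivAt i j (T - p.1, p.2) hp).comp p h1).const_mul ((-1) ^ i)
    exact this.congr_fderiv (by ext <;> simp [pow_succ])
  bounded i j := by
    obtain ⟨C, hC⟩ := h.bounded i j
    exact ⟨C, fun p hp => by simpa [abs_mul] using hC _ hp⟩

lemma exists_continuous (h : BddFamily S F) (hS : IsOpen S) (hc : Convex ℝ S) :
    ∃ G, (∀ i j, Continuous (G i j)) ∧ BddFamily S G ∧ ∀ i j, EqOn (G i j) (F i j) S := by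
  have : ∀ i j, ∃ g : ℝ × ℝ → ℝ, Continuous g ∧ EqOn g (F i j) S := by
    intro i j
    obtain ⟨C, hC⟩ := h.bounded (i + 1) j
    obtain ⟨C', hC'⟩ := h.bounded i (j + 1)
    have hL : LipschitzOnWith (Real.toNNReal (C + C')) (F i j) S :=
      hc.lipschitzOnWith_of_nnnorm_hasFDerivWithin_le
        (fun p hp => (h.hasFDerivAt i j p hp).hasFDerivWithinAt) fun p hp => by
          rw [← NNReal.coe_le_coe, coe_nnnorm]
          exact (norm_covec_le _ _).trans
            ((add_le_add (hC p hp) (hC' p hp)).trans (Real.le_coe_toNNReal _))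
    obtain ⟨g, hg, hgF⟩ := hL.extend_real
    exact ⟨g, hg.continuous, hgF.symm⟩
  choose G hG hGF using this
  exact ⟨G, hG, h.congr hS hGF, hGF⟩

lemma bounded_closure (h : BddFamily S F) (i j : ℕ) (hF : ContinuousOn (F i j) (closure S)) :
    ∃ C, ∀ p ∈ closure S, |F i j p| ≤ C := by
  obtain ⟨C, hC⟩ := h.bounded i j
  exact ⟨C, fun p hp => le_on_closure (f := fun p => |F i j p|) (g := fun _ => C) hC
    hF.abs continuousOn_const hp⟩

lemma hasFDerivWithinAt_closure (h : BddFamily S F) (hS : IsOpen S) (hc : Convex ℝ S)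
    (hF : ∀ i j, ContinuousOn (F i j) (closure S)) (i j : ℕ) {p : ℝ × ℝ} (hp : p ∈ closure S) :
    HasFDerivWithinAt (F i j) (covec (F (i + 1) j p) (F i (j + 1) p)) (closure S) p := by
  refine hasFDerivWithinAt_closure_of_tendsto_fderiv
    (fun q hq => (h.hasFDerivAt i j q hq).differentiableAt.differentiableWithinAt) hc hS
    (fun q hq => (hF i j q hq).mono subset_closure) ?_
  have h1 : Filter.Tendsto (fun q => covec (F (i + 1) j q) (F i (j + 1) q))
      (nhdsWithin p S) (nhds (covec (F (i + 1) j p) (F i (j + 1) p))) :=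
    (continuous_covec.tendsto (F (i + 1) j p, F i (j + 1) p)).comp
      (((hF (i + 1) j p hp).mono subset_closure).tendsto.prodMk_nhds
        ((hF i (j + 1) p hp).mono subset_closure).tendsto)
  refine h1.congr' ?_
  filter_upwards [self_mem_nhdsWithin] with q hq
  exact (h.hasFDerivAt i j q hq).fderiv.symm

lemma contDiff (h : BddFamily univ F) : ContDiff ℝ (⊤ : ℕ∞) (F 0 0) := by
  have : ∀ n : ℕ, ∀ i j, ContDiff ℝ n (F i j) := by
    intro n
    induction n with
    | zero =>
      intro i j
      exact contDiff_zero.2 (continuous_iff_continuousAt.2 fun p =>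
        (h.hasFDerivAt i j p (mem_univ p)).continuousAt)
    | succ n ih =>
      intro i j
      refine contDiff_succ_iff_hasFDerivAt.2 ⟨_, ?_, fun p => h.hasFDerivAt i j p (mem_univ p)⟩
      unfold covec
      exact ((ih _ _).smul contDiff_const).add ((ih _ _).smul contDiff_const)
  exact contDiff_infty.2 fun n => this n 0 0

end BddFamily

/-- Smooth reflection of a bounded family across the vertical axis. -/
noncomputable def reflectionSeries (a : ℕ → ℝ) (F : ℕ → ℕ → ℝ × ℝ → ℝ) (i j : ℕ)
    (p : ℝ × ℝ) : ℝ :=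
  ∑' k : ℕ, a k * (-(4 : ℝ) ^ k) ^ i * F i j (-(4 : ℝ) ^ k * p.1, p.2)

section Reflection

variable {a : ℕ → ℝ} {F : ℕ → ℕ → ℝ × ℝ → ℝ} {J : Set ℝ}

lemma dilation_mem {p : ℝ × ℝ} (hp : p ∈ Iio (0 : ℝ) ×ˢ J) (k : ℕ) :
    (-(4 : ℝ) ^ k * p.1, p.2) ∈ Ioi (0 : ℝ) ×ˢ J :=
  ⟨mem_Ioi.2 (mul_pos_of_neg_of_neg (neg_neg_of_pos (by positivity)) hp.1), hp.2⟩

lemma dilation_mem_closure {p : ℝ × ℝ} (hp : p ∈ closure (Iio (0 : ℝ) ×ˢ J)) (k : ℕ) :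
    (-(4 : ℝ) ^ k * p.1, p.2) ∈ closure (Ioi (0 : ℝ) ×ˢ J) := by
  rw [closure_prod_eq, closure_Ioi]
  rw [closure_prod_eq, closure_Iio] at hp
  exact ⟨mem_Ici.2 (mul_nonneg_of_nonpos_of_nonpos (neg_nonpos.2 (by positivity)) hp.1), hp.2⟩

lemma norm_reflectionSeries_term_le {C : ℝ} {i j : ℕ}
    (hC : ∀ p ∈ closure (Ioi (0 : ℝ) ×ˢ J), |F i j p| ≤ C) (k : ℕ) {p : ℝ × ℝ}
    (hp : p ∈ closure (Iio (0 : ℝ) ×ˢ J)) :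
    ‖a k * (-(4 : ℝ) ^ k) ^ i * F i j (-(4 : ℝ) ^ k * p.1, p.2)‖
      ≤ |a k| * ((4 : ℝ) ^ k) ^ i * C := by
  rw [norm_mul, norm_mul, norm_pow, norm_neg, Real.norm_eq_abs, Real.norm_eq_abs,
    abs_of_nonneg (by positivity : (0 : ℝ) ≤ 4 ^ k)]
  exact mul_le_mul_of_nonneg_left (hC _ (dilation_mem_closure hp k)) (by positivity)

lemma bddFamily_reflectionSeries
    (ha : ∀ n : ℕ, Summable fun k : ℕ => |a k| * ((4 : ℝ) ^ k) ^ n) (hJo : IsOpen J)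
    (hJc : Convex ℝ J) (h : BddFamily (Ioi 0 ×ˢ J) F) (hF : ∀ i j, Continuous (F i j)) :
    BddFamily (Iio 0 ×ˢ J) (reflectionSeries a F) ∧
      ∀ i j, ContinuousOn (reflectionSeries a F i j) (closure (Iio 0 ×ˢ J)) := by
  have hb := fun i j => h.bounded_closure i j (hF i j).continuousOn
  choose C hC using hb
  have hsum : ∀ i j, ∀ p ∈ closure (Iio (0 : ℝ) ×ˢ J), Summable fun k : ℕ =>
      a k * (-(4 : ℝ) ^ k) ^ i * F i j (-(4 : ℝ) ^ k * p.1, p.2) := fun i j p hp =>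
    Summable.of_norm_bounded ((ha i).mul_right (C i j))
      fun k => norm_reflectionSeries_term_le (hC i j) k hp
  refine ⟨⟨fun i j p hp => ?_, fun i j => ⟨∑' k, |a k| * ((4 : ℝ) ^ k) ^ i * C i j,
    fun p hp => ?_⟩⟩, fun i j => ?_⟩
  · have hd : ∀ (k : ℕ), ∀ q ∈ Iio (0 : ℝ) ×ˢ J, HasFDerivAt
        (fun q : ℝ × ℝ => a k * (-(4 : ℝ) ^ k) ^ i * F i j (-(4 : ℝ) ^ k * q.1, q.2))
        (covec (a k * (-(4 : ℝ) ^ k) ^ (i + 1) * F (i + 1) j (-(4 : ℝ) ^ k * q.1, q.2))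
          (a k * (-(4 : ℝ) ^ k) ^ i * F i (j + 1) (-(4 : ℝ) ^ k * q.1, q.2))) q := by
      intro k q hq
      have h1 : HasFDerivAt (fun p : ℝ × ℝ => (-(4 : ℝ) ^ k * p.1, p.2))
          ((-(4 : ℝ) ^ k • ContinuousLinearMap.fst ℝ ℝ ℝ).prod
            (ContinuousLinearMap.snd ℝ ℝ ℝ)) q :=
        (hasFDerivAt_fst.const_mul (-(4 : ℝ) ^ k)).prodMk hasFDerivAt_snd
      have := ((h.hasFDerivAt i j _ (dilation_mem hq k)).comp q h1).const_mul
        (a k * (-(4 : ℝ) ^ k) ^ i)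
      exact this.congr_fderiv (by ext <;> simp [pow_succ]; ring)
    have := hasFDerivAt_tsum_of_isPreconnected
      (((ha (i + 1)).mul_right (C (i + 1) j)).add ((ha i).mul_right (C i (j + 1))))
      (isOpen_Iio.prod hJo) ((convex_Iio 0).prod hJc).isPreconnected hd
      (fun k q hq => (norm_covec_le _ _).trans (add_le_add
        (norm_reflectionSeries_term_le (hC _ _) k (subset_closure hq))
        (norm_reflectionSeries_term_le (hC _ _) k (subset_closure hq))))
      hp (hsum i j p (subset_closure hp)) hp
    refine this.congr_fderiv ?_
    have h1 := (hsum (i + 1) j p (subset_closure hp)).hasSum.smul_const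
      (ContinuousLinearMap.fst ℝ ℝ ℝ)
    have h2 := (hsum i (j + 1) p (subset_closure hp)).hasSum.smul_const
      (ContinuousLinearMap.snd ℝ ℝ ℝ)
    exact (h1.add h2).tsum_eq
  · exact tsum_of_norm_bounded ((ha i).mul_right (C i j)).hasSum
      fun k => norm_reflectionSeries_term_le (hC i j) k (subset_closure hp)
  · refine continuousOn_tsum (fun k => ?_) ((ha i).mul_right (C i j))
      fun k p hp => norm_reflectionSeries_term_le (hC i j) k hp
    have := hF i j
    exact (by fun_prop : Continuous _).continuousOn

end Reflection

lemma reflectionSeries_eq {a : ℕ → ℝ} {F : ℕ → ℕ → ℝ × ℝ → ℝ}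
    (ha : ∀ n : ℕ, ∑' k : ℕ, a k * (-(4 : ℝ) ^ k) ^ n = 1) (i j : ℕ) (y : ℝ) :
    reflectionSeries a F i j (0, y) = F i j (0, y) := by
  simp [reflectionSeries, tsum_mul_right, ha]

/-- A function on a half-strip with bounded derivatives extends to the full strip. -/
lemma BddFamily.exists_extension_of_Ioi {J : Set ℝ} {F : ℕ → ℕ → ℝ × ℝ → ℝ} (hJo : IsOpen J)
    (hJc : Convex ℝ J) (h : BddFamily (Ioi 0 ×ˢ J) F) :
    ∃ G, BddFamily (univ ×ˢ J) G ∧ ∀ p ∈ Ioi (0 : ℝ) ×ˢ J, G 0 0 p = F 0 0 p := by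
  obtain ⟨a, ha, ha1⟩ := exists_reflection_weights
  obtain ⟨F', hF'c, hF', hFF'⟩ := h.exists_continuous (isOpen_Ioi.prod hJo)
    ((convex_Ioi 0).prod hJc)
  obtain ⟨hN, hNc⟩ := bddFamily_reflectionSeries ha hJo hJc hF' hF'c
  set N := reflectionSeries a F' with hNdef
  have hclR : closure (Ioi (0 : ℝ) ×ˢ J) = Ici 0 ×ˢ closure J := by
    rw [closure_prod_eq, closure_Ioi]
  have hclL : closure (Iio (0 : ℝ) ×ˢ J) = Iic 0 ×ˢ closure J := by
    rw [closure_prod_eq, closure_Iio]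
  let G : ℕ → ℕ → ℝ × ℝ → ℝ := fun i j p => if 0 ≤ p.1 then F' i j p else N i j p
  have hGR : ∀ i j, EqOn (G i j) (F' i j) (closure (Ioi (0 : ℝ) ×ˢ J)) := fun i j p hp => by
    rw [hclR] at hp
    exact if_pos hp.1
  have hGL : ∀ i j, EqOn (G i j) (N i j) (closure (Iio (0 : ℝ) ×ˢ J)) := fun i j p hp => by
    rw [hclL] at hp
    rcases (show p.1 ≤ 0 from hp.1).lt_or_eq with h0 | h0
    · exact if_neg (not_le.2 h0)
    · obtain ⟨x, y⟩ := p
      simp only at h0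
      subst h0
      exact (if_pos le_rfl).trans (reflectionSeries_eq ha1 i j y).symm
  have hR : ∀ i j, ∀ p ∈ closure (Ioi (0 : ℝ) ×ˢ J), HasFDerivWithinAt (G i j)
      (covec (G (i + 1) j p) (G i (j + 1) p)) (closure (Ioi (0 : ℝ) ×ˢ J)) p := by
    intro i j p hp
    rw [hGR _ _ hp, hGR _ _ hp]
    exact (hF'.hasFDerivWithinAt_closure (isOpen_Ioi.prod hJo) ((convex_Ioi 0).prod hJc)
      (fun i j => (hF'c i j).continuousOn) i j hp).congr (hGR i j) (hGR i j hp)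
  have hL : ∀ i j, ∀ p ∈ closure (Iio (0 : ℝ) ×ˢ J), HasFDerivWithinAt (G i j)
      (covec (G (i + 1) j p) (G i (j + 1) p)) (closure (Iio (0 : ℝ) ×ˢ J)) p := by
    intro i j p hp
    rw [hGL _ _ hp, hGL _ _ hp]
    exact (hN.hasFDerivWithinAt_closure (isOpen_Iio.prod hJo) ((convex_Iio 0).prod hJc)
      hNc i j hp).congr (hGL i j) (hGL i j hp)
  refine ⟨G, ⟨fun i j p hp => ?_, fun i j => ?_⟩, fun p hp => ?_⟩
  · have hpJ : p.2 ∈ closure J := subset_closure hp.2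
    rcases lt_trichotomy p.1 0 with h0 | h0 | h0
    · exact (hL i j p (subset_closure ⟨h0, hp.2⟩)).hasFDerivAt (Filter.mem_of_superset
        ((isOpen_Iio.prod hJo).mem_nhds ⟨h0, hp.2⟩) subset_closure)
    · have hu := (hR i j p (by rw [hclR]; exact ⟨h0.ge, hpJ⟩)).union
        (hL i j p (by rw [hclL]; exact ⟨h0.le, hpJ⟩))
      refine hu.hasFDerivAt (Filter.mem_of_superset
        ((isOpen_univ.prod hJo).mem_nhds hp) fun q hq => ?_)
      rw [hclR, hclL]
      rcases le_total 0 q.1 with h | h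
      · exact Or.inl ⟨h, subset_closure hq.2⟩
      · exact Or.inr ⟨h, subset_closure hq.2⟩
    · exact (hR i j p (subset_closure ⟨h0, hp.2⟩)).hasFDerivAt (Filter.mem_of_superset
        ((isOpen_Ioi.prod hJo).mem_nhds ⟨h0, hp.2⟩) subset_closure)
  · obtain ⟨C, hC⟩ := hF'.bounded_closure i j (hF'c i j).continuousOn
    obtain ⟨C', hC'⟩ := hN.bounded i j
    refine ⟨max C C', fun p hp => ?_⟩
    by_cases h0 : 0 ≤ p.1
    · rw [show G i j p = F' i j p from if_pos h0]
      exact (hC p (by rw [hclR]; exact ⟨h0, subset_closure hp.2⟩)).trans (le_max_left _ _)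
    · rw [show G i j p = N i j p from if_neg h0]
      exact (hC' p ⟨not_le.1 h0, hp.2⟩).trans (le_max_right _ _)
  · rw [hGR 0 0 (subset_closure hp)]
    exact hFF' 0 0 hp

/-- The mixed partial derivatives, of order `i` in the first variable, of the product of
`χ (l)` (a function of the first variable) and `F m j`. -/
noncomputable def cutoffFamily (χ : ℕ → ℝ → ℝ) (F : ℕ → ℕ → ℝ × ℝ → ℝ) :
    ℕ → ℕ → ℕ → ℕ → ℝ × ℝ → ℝ
  | 0, l, m, j, p => χ l p.1 * F m j p
  | i + 1, l, m, j, p => cutoffFamily χ F i (l + 1) m j p + cutoffFamily χ F i l (m + 1) j p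

lemma BddFamily.cutoff {S : Set (ℝ × ℝ)} {χ : ℕ → ℝ → ℝ} {F : ℕ → ℕ → ℝ × ℝ → ℝ}
    (h0 : ∀ l m j, ∀ p ∈ S, HasFDerivAt (fun p : ℝ × ℝ => χ l p.1 * F m j p)
      (covec (χ (l + 1) p.1 * F m j p + χ l p.1 * F (m + 1) j p) (χ l p.1 * F m (j + 1) p)) p)
    (hb : ∀ l m j, ∃ C, ∀ p ∈ S, |χ l p.1 * F m j p| ≤ C) :
    BddFamily S fun i j => cutoffFamily χ F i 0 0 j := by
  constructor
  · suffices ∀ i l m j, ∀ p ∈ S, HasFDerivAt (cutoffFamily χ F i l m j)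
        (covec (cutoffFamily χ F (i + 1) l m j p) (cutoffFamily χ F i l m (j + 1) p)) p from
      fun i j p hp => this i 0 0 j p hp
    intro i
    induction i with
    | zero => exact h0
    | succ i ih =>
      intro l m j p hp
      refine ((ih (l + 1) m j p hp).add (ih l (m + 1) j p hp)).congr_fderiv ?_
      ext
      · simp only [cutoffFamily, ContinuousLinearMap.comp_apply, add_apply,
          covec_apply, ContinuousLinearMap.inl_apply]
        ring
      · simp only [cutoffFamily, ContinuousLinearMap.comp_apply, add_apply,
          covec_apply, ContinuousLinearMap.inr_apply]
        ring
  · suffices ∀ i l m j, ∃ C, ∀ p ∈ S, |cutoffFamily χ F i l m j p| ≤ C from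
      fun i j => this i 0 0 j
    intro i
    induction i with
    | zero => exact hb
    | succ i ih =>
      intro l m j
      obtain ⟨C, hC⟩ := ih (l + 1) m j
      obtain ⟨C', hC'⟩ := ih l (m + 1) j
      exact ⟨C + C', fun p hp => (abs_add_le _ _).trans (add_le_add (hC p hp) (hC' p hp))⟩

lemma ContDiff.hasDerivAt_iteratedDeriv {f : ℝ → ℝ} (hf : ContDiff ℝ (⊤ : ℕ∞) f) (n : ℕ)
    (x : ℝ) : HasDerivAt (iteratedDeriv n f) (iteratedDeriv (n + 1) f x) x := by
  rw [iteratedDeriv_succ]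
  exact ((hf.differentiable_iteratedDeriv n (by exact_mod_cast WithTop.coe_lt_top n)) x).hasDerivAt

/-- A bounded family on `(0, T) × J`, multiplied by a smooth function of the first variable
vanishing near `T`, extends to `ℝ × J`. -/
lemma BddFamily.exists_extension_cutoff {J : Set ℝ} {F : ℕ → ℕ → ℝ × ℝ → ℝ} (hJo : IsOpen J)
    (hJc : Convex ℝ J) {T b : ℝ} (hb : b < T) (h : BddFamily (Ioo 0 T ×ˢ J) F) {χ : ℝ → ℝ}
    (hχ : ContDiff ℝ (⊤ : ℕ∞) χ) (hχ0 : ∀ x, b < x → χ x = 0) :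
    ∃ G, BddFamily (univ ×ˢ J) G ∧
      ∀ p ∈ Ioo (0 : ℝ) T ×ˢ J, G 0 0 p = χ p.1 * F 0 0 p := by
  let F₀ : ℕ → ℕ → ℝ × ℝ → ℝ := fun i j p => if p.1 < T then F i j p else 0
  have hF₀ : ∀ i j, EqOn (F₀ i j) (F i j) (Ioo 0 T ×ˢ J) := fun i j p hp => if_pos hp.1.2
  have hopen : IsOpen (Ioo 0 T ×ˢ J) := isOpen_Ioo.prod hJo
  have h₀ := h.congr hopen hF₀
  have hvan : ∀ l x, b < x → iteratedDeriv l χ x = 0 := by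
    intro l x hx
    have : χ =ᶠ[nhds x] fun _ => 0 :=
      Filter.eventually_of_mem (Ioi_mem_nhds hx) fun y hy => hχ0 y hy
    rw [this.iteratedDeriv_eq l]
    simp
  have hfam : BddFamily (Ioi 0 ×ˢ J)
      fun i j => cutoffFamily (fun l => iteratedDeriv l χ) F₀ i 0 0 j := by
    refine BddFamily.cutoff (fun l m j p hp => ?_) (fun l m j => ?_)
    · by_cases hpT : p.1 < T
      · have h1 : HasFDerivAt (fun p : ℝ × ℝ => iteratedDeriv l χ p.1)
            (iteratedDeriv (l + 1) χ p.1 • ContinuousLinearMap.fst ℝ ℝ ℝ) p :=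
          (hχ.hasDerivAt_iteratedDeriv l p.1).comp_hasFDerivAt p hasFDerivAt_fst
        refine (h1.mul (h₀.hasFDerivAt m j p ⟨⟨hp.1, hpT⟩, hp.2⟩)).congr_fderiv ?_
        ext <;> simp; ring
      · have hbp : b < p.1 := hb.trans_le (not_lt.1 hpT)
        have hz : (fun p : ℝ × ℝ => iteratedDeriv l χ p.1 * F₀ m j p) =ᶠ[nhds p] fun _ => 0 := by
          filter_upwards [continuous_fst.continuousAt.preimage_mem_nhds (Ioi_mem_nhds hbp)]
            with q hq
          rw [hvan l q.1 hq, zero_mul]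
        refine ((hasFDerivAt_const (0 : ℝ) p).congr_of_eventuallyEq hz).congr_fderiv ?_
        simp only [hvan _ _ hbp]
        ext <;> simp
    · obtain ⟨C, hC⟩ := h₀.bounded m j
      obtain ⟨D, hD⟩ := isCompact_Icc.exists_bound_of_continuousOn (s := Icc 0 T)
        (f := iteratedDeriv l χ)
        (hχ.continuous_iteratedDeriv l (by exact_mod_cast le_top)).continuousOn
      refine ⟨max (D * C) 0, fun p hp => ?_⟩
      by_cases hpT : p.1 < T
      · refine le_trans ?_ (le_max_left _ _)
        rw [abs_mul]
        have h1 := hD p.1 ⟨le_of_lt hp.1, hpT.le⟩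
        exact mul_le_mul h1 (hC p ⟨⟨hp.1, hpT⟩, hp.2⟩) (abs_nonneg _) ((norm_nonneg _).trans h1)
      · simp [F₀, hpT]
  obtain ⟨G, hG, hGF⟩ := hfam.exists_extension_of_Ioi hJo hJc
  refine ⟨G, hG, fun p hp => ?_⟩
  rw [hGF p ⟨hp.1.1, hp.2⟩]
  simp [cutoffFamily, hF₀ 0 0 hp]

/-- A function on `(0, T) × J` with bounded derivatives extends to `ℝ × J`. -/
lemma BddFamily.exists_extension_of_Ioo {J : Set ℝ} {F : ℕ → ℕ → ℝ × ℝ → ℝ} (hJo : IsOpen J)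
    (hJc : Convex ℝ J) {T : ℝ} (hT : 0 < T) (h : BddFamily (Ioo 0 T ×ˢ J) F) :
    ∃ G, BddFamily (univ ×ˢ J) G ∧ ∀ p ∈ Ioo (0 : ℝ) T ×ˢ J, G 0 0 p = F 0 0 p := by
  let χ : ℝ → ℝ := fun x => Real.smoothTransition (2 - 3 * x / T)
  have hχ : ContDiff ℝ (⊤ : ℕ∞) χ :=
    Real.smoothTransition.contDiff.comp (by fun_prop)
  have hχ0 : ∀ x, 2 * T / 3 < x → χ x = 0 := fun x hx =>
    Real.smoothTransition.zero_of_nonpos (by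
      rw [sub_nonpos, le_div_iff₀ hT]; linarith)
  have hχ1 : ∀ x, x < T / 3 → χ x = 1 := fun x hx =>
    Real.smoothTransition.one_of_one_le (by
      have : 3 * x / T ≤ 1 := by rw [div_le_iff₀ hT]; linarith
      linarith)
  obtain ⟨G₁, hG₁, hG₁F⟩ := h.exists_extension_cutoff hJo hJc (by linarith : 2 * T / 3 < T)
    hχ hχ0
  have hr : (fun p : ℝ × ℝ => (T - p.1, p.2)) ⁻¹' (Ioo 0 T ×ˢ J) = Ioo 0 T ×ˢ J := by
    ext p
    simp only [mem_preimage, mem_prod, mem_Ioo]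
    constructor <;> rintro ⟨⟨h1, h2⟩, h3⟩ <;> exact ⟨⟨by linarith, by linarith⟩, h3⟩
  have hrefl := h.reflect T
  rw [hr] at hrefl
  obtain ⟨G₂, hG₂, hG₂F⟩ := hrefl.exists_extension_cutoff hJo hJc (by linarith : 2 * T / 3 < T)
    (χ := fun x => 1 - χ (T - x)) (contDiff_const.sub (hχ.comp (by fun_prop)))
    (fun x hx => by rw [hχ1 (T - x) (by linarith), sub_self])
  have hG₂r := hG₂.reflect T
  refine ⟨_, hG₁.add (hG₂r.mono fun p hp => ⟨mem_univ _, hp.2⟩), fun p hp => ?_⟩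
  have hp' : ((T - p.1, p.2) : ℝ × ℝ) ∈ Ioo (0 : ℝ) T ×ˢ J := by rwa [← hr] at hp
  simp only [pow_zero, one_mul]
  rw [hG₁F p hp, hG₂F _ hp']
  simp only [pow_zero, one_mul, sub_sub_cancel, Prod.mk.eta]
  ring

/-- A function on `(0, T) × (0, T)` with bounded derivatives extends to the plane. -/
lemma BddFamily.exists_contDiff_extension {F : ℕ → ℕ → ℝ × ℝ → ℝ} {T : ℝ} (hT : 0 < T)
    (h : BddFamily (Ioo 0 T ×ˢ Ioo 0 T) F) :
    ∃ W : ℝ × ℝ → ℝ, ContDiff ℝ (⊤ : ℕ∞) W ∧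
      ∀ p ∈ Ioo (0 : ℝ) T ×ˢ Ioo (0 : ℝ) T, W p = F 0 0 p := by
  obtain ⟨G, hG, hGF⟩ := h.exists_extension_of_Ioo isOpen_Ioo (convex_Ioo 0 T) hT
  obtain ⟨H, hH, hHG⟩ := (hG.swap.mono (S' := Ioo 0 T ×ˢ univ)
    fun p hp => ⟨mem_univ _, hp.1⟩).exists_extension_of_Ioo isOpen_univ convex_univ hT
  have := hH.mono (S' := univ) (by simp)
  refine ⟨fun p => H 0 0 p.swap, this.contDiff.comp (contDiff_snd.prodMk contDiff_fst),
    fun p hp => ?_⟩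
  change H 0 0 p.swap = _
  rw [hHG p.swap ⟨hp.2, mem_univ _⟩, Prod.swap_swap, hGF p hp]

/-- The functions on the plane that are smooth on `Ω`. -/
def smoothOn (Ω : Set (ℝ × ℝ)) : Subalgebra ℝ (ℝ × ℝ → ℝ) where
  carrier := {f | ContDiffOn ℝ (⊤ : ℕ∞) f Ω}
  mul_mem' hf hg := ContDiffOn.mul hf hg
  add_mem' hf hg := ContDiffOn.add hf hg
  algebraMap_mem' _ := contDiffOn_const

section SmoothOn

variable {Ω : Set (ℝ × ℝ)}

lemma differentiableAt_of_smoothOn (hΩ : IsOpen Ω) (f : smoothOn Ω) {p : ℝ × ℝ} (hp : p ∈ Ω) :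
    DifferentiableAt ℝ f.1 p :=
  (f.2.differentiableOn (by simp)).differentiableAt (hΩ.mem_nhds hp)

/-- The derivative in the direction `v`, extended by zero off `Ω`. -/
noncomputable def dirDeriv (hΩ : IsOpen Ω) (v : ℝ × ℝ) : Derivation ℝ (smoothOn Ω) (smoothOn Ω) :=
  Derivation.mk'
    { toFun := fun f => ⟨Ω.indicator fun p => fderiv ℝ f.1 p v, by
        have h : ContDiffOn ℝ (⊤ : ℕ∞) (fun p => fderiv ℝ f.1 p v) Ω :=
          (f.2.fderiv_of_isOpen hΩ (by simp)).clm_apply contDiffOn_const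
        exact h.congr fun p hp => indicator_of_mem hp _⟩
      map_add' := fun f g => by
        ext p
        by_cases hp : p ∈ Ω
        · have := fderiv_add (differentiableAt_of_smoothOn hΩ f hp)
            (differentiableAt_of_smoothOn hΩ g hp)
          simp [hp, this]
        · simp [hp]
      map_smul' := fun c f => by
        ext p
        by_cases hp : p ∈ Ω
        · have := fderiv_const_smul (differentiableAt_of_smoothOn hΩ f hp) c
          simp [hp, this]
        · simp [hp] }
    fun f g => by
      ext p
      by_cases hp : p ∈ Ω
      · have := fderiv_mul (differentiableAt_of_smoothOn hΩ f hp)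
          (differentiableAt_of_smoothOn hΩ g hp)
        simp [hp, this]
      · simp [hp]

variable (hΩ : IsOpen Ω)

lemma dirDeriv_apply (v : ℝ × ℝ) (f : smoothOn Ω) {p : ℝ × ℝ} (hp : p ∈ Ω) :
    (dirDeriv hΩ v f).1 p = fderiv ℝ f.1 p v :=
  indicator_of_mem hp fun p => fderiv ℝ f.1 p v

lemma dirDeriv_apply_of_notMem (v : ℝ × ℝ) (f : smoothOn Ω) {p : ℝ × ℝ} (hp : p ∉ Ω) :
    (dirDeriv hΩ v f).1 p = 0 :=
  indicator_of_notMem hp fun p => fderiv ℝ f.1 p v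

lemma dirDeriv_congr (v : ℝ × ℝ) {f g : smoothOn Ω} (h : EqOn f.1 g.1 Ω) :
    dirDeriv hΩ v f = dirDeriv hΩ v g := by
  ext p
  by_cases hp : p ∈ Ω
  · rw [dirDeriv_apply hΩ v f hp, dirDeriv_apply hΩ v g hp,
      (h.eventuallyEq_of_mem (hΩ.mem_nhds hp)).fderiv_eq]
  · rw [dirDeriv_apply_of_notMem hΩ v f hp, dirDeriv_apply_of_notMem hΩ v g hp]

lemma dirDeriv_add (u v : ℝ × ℝ) (f : smoothOn Ω) :
    dirDeriv hΩ (u + v) f = dirDeriv hΩ u f + dirDeriv hΩ v f := by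
  ext p
  by_cases hp : p ∈ Ω
  · simp [dirDeriv_apply hΩ _ f hp]
  · simp [dirDeriv_apply_of_notMem hΩ _ f hp]

lemma dirDeriv_comm (u v : ℝ × ℝ) :
    Function.Commute (dirDeriv hΩ u) (dirDeriv hΩ v) := by
  intro f
  have key : ∀ u v : ℝ × ℝ, ∀ p ∈ Ω, (dirDeriv hΩ u (dirDeriv hΩ v f)).1 p
      = fderiv ℝ (fderiv ℝ f.1) p u v := by
    intro u v p hp
    rw [dirDeriv_apply hΩ u _ hp]
    have he : (dirDeriv hΩ v f).1 =ᶠ[nhds p] fun q => fderiv ℝ f.1 q v :=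
      Filter.eventually_of_mem (hΩ.mem_nhds hp) fun q hq => dirDeriv_apply hΩ v f hq
    have hd : DifferentiableAt ℝ (fderiv ℝ f.1) p :=
      ((f.2.fderiv_of_isOpen (m := 1) hΩ (by norm_cast)).differentiableOn
        (by simp)).differentiableAt (hΩ.mem_nhds hp)
    rw [he.fderiv_eq, fderiv_clm_apply hd (differentiableAt_const _)]
    simp
  ext p
  by_cases hp : p ∈ Ω
  · rw [key u v p hp, key v u p hp]
    have hs : IsSymmSndFDerivAt ℝ f.1 p :=
      (f.2.contDiffAt (hΩ.mem_nhds hp)).isSymmSndFDerivAt (by simp; norm_cast)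
    exact hs u v
  · rw [dirDeriv_apply_of_notMem hΩ _ _ hp, dirDeriv_apply_of_notMem hΩ _ _ hp]

/-- All the iterated derivatives of `f` of order at most `n` have the property `P`. -/
def AllDerivs (P : smoothOn Ω → Prop) : ℕ → smoothOn Ω → Prop
  | 0, f => P f
  | n + 1, f => P f ∧ ∀ v, AllDerivs P n (dirDeriv hΩ v f)

/-- `f` vanishes to infinite order at the origin. -/
def IsFlat (f : smoothOn Ω) : Prop :=
  ∀ N : ℕ, ∃ C, ∀ p ∈ Ω, |f.1 p| ≤ C * (p.1 + p.2) ^ N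

/-- Multiplication by `c` preserves flatness at the origin. -/
def IsFlatMultiplier (c : smoothOn Ω) : Prop :=
  ∀ f, IsFlat f → IsFlat (c * f)

lemma IsFlat.add {f g : smoothOn Ω} (hf : IsFlat f) (hg : IsFlat g) : IsFlat (f + g) := by
  intro N
  obtain ⟨C, hC⟩ := hf N
  obtain ⟨C', hC'⟩ := hg N
  refine ⟨C + C', fun p hp => (abs_add_le _ _).trans ?_⟩
  rw [add_mul]
  exact add_le_add (hC p hp) (hC' p hp)

lemma IsFlat.neg {f : smoothOn Ω} (hf : IsFlat f) : IsFlat (-f) := fun N =>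
  (hf N).imp fun _ hC p hp => (abs_neg _).trans_le (hC p hp)

lemma IsFlat.sub {f g : smoothOn Ω} (hf : IsFlat f) (hg : IsFlat g) : IsFlat (f - g) := by
  rw [sub_eq_add_neg]; exact hf.add hg.neg

lemma IsFlat.congr {f g : smoothOn Ω} (hf : IsFlat f) (h : EqOn g.1 f.1 Ω) : IsFlat g :=
  fun N => (hf N).imp fun _ hC p hp => by rw [h hp]; exact hC p hp

namespace IsFlatMultiplier

lemma add {c d : smoothOn Ω} (hc : IsFlatMultiplier c) (hd : IsFlatMultiplier d) :
    IsFlatMultiplier (c + d) := fun f hf => by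
  rw [add_mul]; exact (hc f hf).add (hd f hf)

lemma mul {c d : smoothOn Ω} (hc : IsFlatMultiplier c) (hd : IsFlatMultiplier d) :
    IsFlatMultiplier (c * d) := fun f hf => by
  rw [mul_assoc]; exact hc _ (hd f hf)

lemma congr {c d : smoothOn Ω} (hc : IsFlatMultiplier c) (h : EqOn d.1 c.1 Ω) :
    IsFlatMultiplier d := fun f hf =>
  (hc f hf).congr fun p hp => by
    change d.1 p * f.1 p = c.1 p * f.1 p
    rw [h hp]

lemma of_bounded {c : smoothOn Ω} {B : ℝ} (h : ∀ p ∈ Ω, |c.1 p| ≤ B) : IsFlatMultiplier c := by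
  intro f hf N
  obtain ⟨C, hC⟩ := hf N
  refine ⟨B * C, fun p hp => ?_⟩
  change |c.1 p * f.1 p| ≤ _
  rw [abs_mul, mul_assoc]
  exact mul_le_mul (h p hp) (hC p hp) (abs_nonneg _) ((abs_nonneg _).trans (h p hp))

end IsFlatMultiplier

lemma AllDerivs.of_succ {P : smoothOn Ω → Prop} {n : ℕ} {f : smoothOn Ω}
    (h : AllDerivs hΩ P (n + 1) f) : AllDerivs hΩ P n f := by
  induction n generalizing f with
  | zero => exact h.1
  | succ n ih => exact ⟨h.1, fun v => ih (h.2 v)⟩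

namespace AllDerivs

variable {hΩ} {n : ℕ} {c d : smoothOn Ω}

lemma flatMultiplier_congr (h : AllDerivs hΩ IsFlatMultiplier n c) (hcd : EqOn d.1 c.1 Ω) :
    AllDerivs hΩ IsFlatMultiplier n d := by
  cases n with
  | zero => exact IsFlatMultiplier.congr h hcd
  | succ n =>
    refine ⟨h.1.congr hcd, fun v => ?_⟩
    rw [dirDeriv_congr hΩ v hcd]
    exact h.2 v

lemma flatMultiplier_add (hc : AllDerivs hΩ IsFlatMultiplier n c)
    (hd : AllDerivs hΩ IsFlatMultiplier n d) : AllDerivs hΩ IsFlatMultiplier n (c + d) := by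
  induction n generalizing c d with
  | zero => exact IsFlatMultiplier.add hc hd
  | succ n ih =>
    refine ⟨hc.1.add hd.1, fun v => ?_⟩
    rw [map_add]
    exact ih (hc.2 v) (hd.2 v)

lemma flatMultiplier_mul (hc : AllDerivs hΩ IsFlatMultiplier n c)
    (hd : AllDerivs hΩ IsFlatMultiplier n d) : AllDerivs hΩ IsFlatMultiplier n (c * d) := by
  induction n generalizing c d with
  | zero => exact IsFlatMultiplier.mul hc hd
  | succ n ih =>
    refine ⟨hc.1.mul hd.1, fun v => ?_⟩
    rw [Derivation.leibniz, smul_eq_mul, smul_eq_mul]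
    exact flatMultiplier_add (ih hc.of_succ (hd.2 v)) (ih hd.of_succ (hc.2 v))

lemma flatMultiplier_const (r : ℝ) :
    AllDerivs hΩ IsFlatMultiplier n (algebraMap ℝ (smoothOn Ω) r) := by
  induction n generalizing r with
  | zero => exact IsFlatMultiplier.of_bounded (B := |r|) fun p _ => le_rfl
  | succ n ih =>
    refine ⟨IsFlatMultiplier.of_bounded (B := |r|) fun p _ => le_rfl, fun v => ?_⟩
    rw [Derivation.map_algebraMap, ← map_zero (algebraMap ℝ (smoothOn Ω))]
    exact ih 0

end AllDerivs

section Leibniz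

variable {hΩ} {c w : smoothOn Ω}

lemma IsFlat.iterate_mul {v : ℝ × ℝ} {k : ℕ} {f : smoothOn Ω}
    (hc : ∀ n, AllDerivs hΩ IsFlatMultiplier n c)
    (hf : ∀ j ≤ k, IsFlat ((dirDeriv hΩ v)^[j] f)) : IsFlat ((dirDeriv hΩ v)^[k] (c * f)) := by
  induction k generalizing c f with
  | zero => exact hc 0 _ (hf 0 le_rfl)
  | succ k ih =>
    rw [Function.iterate_succ_apply, Derivation.leibniz, smul_eq_mul, smul_eq_mul,
      iterate_map_add, mul_comm f]
    exact (ih hc fun j hj => hf (j + 1) (by omega)).add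
      (ih (fun n => (hc (n + 1)).2 v) fun j hj => hf j (by omega))

lemma IsFlat.iterate_mul_sub {v : ℝ × ℝ} {k : ℕ} {f : smoothOn Ω}
    (hc : ∀ n, AllDerivs hΩ IsFlatMultiplier n c)
    (hf : ∀ j < k, IsFlat ((dirDeriv hΩ v)^[j] f)) :
    IsFlat ((dirDeriv hΩ v)^[k] (c * f) - c * (dirDeriv hΩ v)^[k] f) := by
  induction k generalizing f with
  | zero =>
    rw [Function.iterate_zero_apply, Function.iterate_zero_apply, sub_self]
    exact fun N => ⟨0, fun p _ => by simp⟩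
  | succ k ih =>
    rw [Function.iterate_succ_apply, Derivation.leibniz, smul_eq_mul, smul_eq_mul,
      iterate_map_add, mul_comm f, Function.iterate_succ_apply, add_sub_right_comm]
    exact (ih fun j hj => hf (j + 1) (by omega)).add
      (IsFlat.iterate_mul (fun n => (hc (n + 1)).2 v) fun j hj => hf j (by omega))

lemma IsFlat.iterate_iterate_mul {u v : ℝ × ℝ} {n : ℕ} {f : smoothOn Ω}
    (hc : ∀ n, AllDerivs hΩ IsFlatMultiplier n c)
    (hf : ∀ i ≤ n, ∀ k, IsFlat ((dirDeriv hΩ u)^[i] ((dirDeriv hΩ v)^[k] f))) (k : ℕ) :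
    IsFlat ((dirDeriv hΩ u)^[n] ((dirDeriv hΩ v)^[k] (c * f))) := by
  induction n generalizing c f with
  | zero => exact IsFlat.iterate_mul hc fun j _ => hf 0 le_rfl j
  | succ n ih =>
    rw [Function.iterate_succ_apply, (dirDeriv_comm hΩ u v).iterate_right k, Derivation.leibniz,
      smul_eq_mul, smul_eq_mul, iterate_map_add, iterate_map_add, mul_comm f]
    refine (ih hc fun i hi k => ?_).add (ih (fun n => (hc (n + 1)).2 u) fun i hi k =>
      hf i (by omega) k)
    have := hf (i + 1) (by omega) k
    rwa [Function.iterate_succ_apply, (dirDeriv_comm hΩ u v).iterate_right k] at this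

/-- If the characteristic Cauchy problem for `∂₁∂₂ u = c u + s` preserves flatness, then all the
derivatives of a solution of `∂₁∂₂ w = c w` with flat Cauchy data are flat. -/
lemma isFlat_iterate_iterate (hc : ∀ n, AllDerivs hΩ IsFlatMultiplier n c)
    (hw : dirDeriv hΩ (1, 0) (dirDeriv hΩ (0, 1) w) = c * w) (D : smoothOn Ω → Prop)
    (hD : ∀ u s, IsFlat s → dirDeriv hΩ (1, 0) (dirDeriv hΩ (0, 1) u) = c * u + s →
      D u → D (dirDeriv hΩ (1, 0) u) → D (dirDeriv hΩ (1, 1) u) →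
      IsFlat u ∧ IsFlat (dirDeriv hΩ (1, 0) u))
    (h1 : ∀ k, D ((dirDeriv hΩ (1, 1))^[k] w))
    (h2 : ∀ k, D ((dirDeriv hΩ (1, 1))^[k] (dirDeriv hΩ (1, 0) w))) (i j : ℕ) :
    IsFlat ((dirDeriv hΩ (1, 0))^[i] ((dirDeriv hΩ (0, 1))^[j] w)) := by
  have hsum : ∀ f, dirDeriv hΩ (1, 1) f = dirDeriv hΩ (1, 0) f + dirDeriv hΩ (0, 1) f := by
    intro f
    rw [← dirDeriv_add]
    simp
  have c1 := dirDeriv_comm hΩ (1, 0) (1, 1)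
  have c2 := dirDeriv_comm hΩ (0, 1) (1, 1)
  have c3 := dirDeriv_comm hΩ (1, 0) (0, 1)
  have base : ∀ k, IsFlat ((dirDeriv hΩ (1, 1))^[k] w) ∧
      IsFlat (dirDeriv hΩ (1, 0) ((dirDeriv hΩ (1, 1))^[k] w)) := by
    intro k
    induction k using Nat.strong_induction_on with
    | _ k ih =>
      refine hD _ _ (IsFlat.iterate_mul_sub (v := (1, 1)) (k := k) hc fun j hj => (ih j hj).1)
        ?_ (h1 k) ?_ ?_
      · rw [c2.iterate_right k, c1.iterate_right k, hw]
        ring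
      · rw [c1.iterate_right k]
        exact h2 k
      · have := h1 (k + 1)
        rwa [Function.iterate_succ_apply'] at this
  have main : ∀ n k, IsFlat ((dirDeriv hΩ (1, 0))^[n] ((dirDeriv hΩ (1, 1))^[k] w)) := by
    intro n
    induction n using Nat.strong_induction_on with
    | _ n ih =>
      intro k
      match n with
      | 0 => exact (base k).1
      | 1 => exact (base k).2
      | n + 2 =>
        have e : dirDeriv hΩ (1, 0) (dirDeriv hΩ (1, 0) w)
            = dirDeriv hΩ (1, 0) (dirDeriv hΩ (1, 1) w) - c * w := by
          rw [hsum w, map_add, hw]; ring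
        rw [Function.iterate_succ_apply, Function.iterate_succ_apply, c1.iterate_right k,
          c1.iterate_right k, e, iterate_map_sub, iterate_map_sub,
          ← c1.iterate_right k, ← Function.iterate_succ_apply, ← Function.iterate_succ_apply]
        exact (ih (n + 1) (by omega) (k + 1)).sub
          (IsFlat.iterate_iterate_mul hc (fun i hi k => ih i (by omega) k) k)
  suffices ∀ j i k, IsFlat ((dirDeriv hΩ (1, 0))^[i] ((dirDeriv hΩ (0, 1))^[j]
      ((dirDeriv hΩ (1, 1))^[k] w))) from this j i 0
  intro j
  induction j with
  | zero => exact main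
  | succ j ih =>
    intro i k
    have e : dirDeriv hΩ (0, 1) ((dirDeriv hΩ (1, 1))^[k] w) =
        (dirDeriv hΩ (1, 1))^[k + 1] w - dirDeriv hΩ (1, 0) ((dirDeriv hΩ (1, 1))^[k] w) := by
      rw [Function.iterate_succ_apply', hsum]; ring
    rw [Function.iterate_succ_apply, e, iterate_map_sub, iterate_map_sub,
      ← c3.iterate_right j, ← Function.iterate_succ_apply]
    exact (ih i (k + 1)).sub (ih (i + 1) k)

end Leibniz

end SmoothOn

lemma abs_sub_le_of_hasDerivAt {f f' : ℝ → ℝ} {a b C : ℝ} (hab : a ≤ b)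
    (hf : ∀ x ∈ Icc a b, HasDerivAt f (f' x) x) (hC : ∀ x ∈ Icc a b, |f' x| ≤ C) :
    |f b - f a| ≤ C * (b - a) := by
  have := (convex_Icc a b).norm_image_sub_le_of_norm_hasDerivWithin_le
    (fun x hx => (hf x hx).hasDerivWithinAt) hC (left_mem_Icc.2 hab) (right_mem_Icc.2 hab)
  rwa [Real.norm_eq_abs, Real.norm_eq_abs, abs_of_nonneg (sub_nonneg.2 hab)] at this

/-- Contraction estimate for the characteristic Cauchy problem above the diagonal. -/
lemma abs_le_of_characteristic {T K A : ℝ} {N : ℕ} {u v r : ℝ → ℝ → ℝ} (hA : 0 ≤ A)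
    (hK : 0 ≤ K) (hKT : K * T ≤ 1 / 2)
    (hu : ContinuousOn (fun p : ℝ × ℝ => u p.1 p.2) (Ioo 0 T ×ˢ Ioo 0 T))
    (huv : ∀ x ∈ Ioo 0 T, ∀ y ∈ Ioo 0 T, HasDerivAt (fun y => u x y) (v x y) y)
    (hvr : ∀ x ∈ Ioo 0 T, ∀ y ∈ Ioo 0 T, HasDerivAt (fun x => v x y) (r x y) x)
    (hr : ∀ x ∈ Ioo 0 T, ∀ y ∈ Ioo 0 T, x ≤ y → |r x y| ≤ K / y * |u x y| + A * y ^ N)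
    (hu0 : ∀ x ∈ Ioo 0 T, |u x x| ≤ A * x ^ N) (hv0 : ∀ x ∈ Ioo 0 T, |v x x| ≤ A * x ^ N)
    {x₀ y₀ : ℝ} (hx₀ : 0 < x₀) (hxy : x₀ ≤ y₀) (hy₀ : y₀ < T) :
    |u x₀ y₀| ≤ 2 * A * (1 + T + T ^ 2) * y₀ ^ N := by
  set S : Set (ℝ × ℝ) := {p | x₀ ≤ p.1 ∧ p.1 ≤ p.2 ∧ p.2 ≤ y₀} with hS
  have hT : 0 < T := by linarith
  have hSc : IsCompact S := by
    refine (isCompact_Icc (a := (x₀, x₀)) (b := (y₀, y₀))).of_isClosed_subset ?_ ?_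
    · exact (isClosed_le continuous_const continuous_fst).inter
        ((isClosed_le continuous_fst continuous_snd).inter
          (isClosed_le continuous_snd continuous_const))
    · rintro ⟨x, y⟩ ⟨h1, h2, h3⟩
      exact ⟨⟨h1, h1.trans h2⟩, ⟨h2.trans h3, h3⟩⟩
  have hSΩ : ∀ p ∈ S, p.1 ∈ Ioo 0 T ∧ p.2 ∈ Ioo 0 T := by
    rintro ⟨x, y⟩ ⟨h1, h2, h3⟩
    simp only at h1 h2 h3
    exact ⟨⟨by linarith, by linarith⟩, ⟨by linarith, by linarith⟩⟩
  obtain ⟨q, hq, hmax⟩ := hSc.exists_isMaxOn (f := fun p : ℝ × ℝ => |u p.1 p.2| / p.2 ^ N)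
    ⟨(x₀, y₀), le_rfl, hxy, le_rfl⟩
    ((hu.mono fun p hp => hSΩ p hp).abs.div (by fun_prop) fun p hp =>
      pow_ne_zero _ (hSΩ p hp).2.1.ne')
  set M := |u q.1 q.2| / q.2 ^ N with hM
  have hM0 : 0 ≤ M := div_nonneg (abs_nonneg _) (pow_nonneg (hSΩ q hq).2.1.le _)
  have hMle : ∀ x y, (x, y) ∈ S → |u x y| ≤ M * y ^ N := fun x y h => by
    have := hmax h
    exact (div_le_iff₀ (pow_pos (hSΩ _ h).2.1 _)).1 this
  have hv : ∀ x y, (x, y) ∈ S → |v x y| ≤ (A + K * M + A * T) * y ^ N := fun x y h => by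
    obtain ⟨h1, h2, h3⟩ := h
    simp only at h1 h2 h3
    have hy0 : 0 < y := by linarith
    have hd := abs_sub_le_of_hasDerivAt (f := fun x => v x y) (f' := fun x => r x y)
      (C := K / y * (M * y ^ N) + A * y ^ N) h2
      (fun z hz => hvr z ⟨by linarith [hz.1], by linarith [hz.2]⟩ y ⟨hy0, by linarith⟩)
      fun z hz => by
        have hz' : (z, y) ∈ S := ⟨h1.trans hz.1, hz.2, h3⟩
        refine (hr z (hSΩ _ hz').1 y (hSΩ _ hz').2 hz.2).trans ?_
        gcongr
        exact hMle z y hz'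
    have h0 := hv0 y ⟨hy0, by linarith⟩
    have e : (K / y * (M * y ^ N) + A * y ^ N) * (y - x) ≤ (K * M + A * T) * y ^ N := by
      calc _ ≤ (K / y * (M * y ^ N) + A * y ^ N) * y := by
            gcongr
            linarith
        _ = (K * M + A * y) * y ^ N := by field_simp
        _ ≤ _ := by
            gcongr
            linarith
    have t : |v x y| ≤ |v y y| + |v y y - v x y| := by
      have := abs_sub_abs_le_abs_sub (v x y) (v y y)
      rw [abs_sub_comm] at this
      linarith
    linarith
  have hfin : ∀ x y, (x, y) ∈ S → |u x y| ≤ (A + T * (A + K * M + A * T)) * y ^ N :=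
      fun x y h => by
    obtain ⟨h1, h2, h3⟩ := h
    simp only at h1 h2 h3
    have hx0 : 0 < x := by linarith
    have hd := abs_sub_le_of_hasDerivAt (f := fun y => u x y) (f' := fun y => v x y)
      (C := (A + K * M + A * T) * y ^ N) h2
      (fun z hz => huv x ⟨hx0, by linarith⟩ z ⟨by linarith [hz.1], by linarith [hz.2]⟩)
      fun z hz => by
        refine (hv x z ⟨h1, hz.1, hz.2.trans h3⟩).trans ?_
        have : 0 ≤ z := by linarith [hz.1]
        gcongr
        exact hz.2
    have h0 := hu0 x ⟨hx0, by linarith⟩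
    have e : (A + K * M + A * T) * y ^ N * (y - x) ≤ T * (A + K * M + A * T) * y ^ N := by
      have : 0 ≤ y := by linarith
      calc _ ≤ (A + K * M + A * T) * y ^ N * T := by
            gcongr
            linarith
        _ = _ := by ring
    have e' : A * x ^ N ≤ A * y ^ N := by gcongr
    have t := abs_sub_abs_le_abs_sub (u x y) (u x x)
    linarith
  have hMq : M ≤ A + T * (A + K * M + A * T) := by
    rw [hM, div_le_iff₀ (pow_pos (hSΩ _ hq).2.1 _)]
    exact hfin q.1 q.2 hq
  have hM2 : M ≤ 2 * A * (1 + T + T ^ 2) := by nlinarith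
  refine (hMle x₀ y₀ ⟨le_rfl, hxy, le_rfl⟩).trans ?_
  have : 0 ≤ y₀ := by linarith
  gcongr

section DiagFlat

lemma hasDerivAt_comp_dirDeriv {Ω : Set (ℝ × ℝ)} (hΩ : IsOpen Ω) (f : smoothOn Ω)
    {γ : ℝ → ℝ × ℝ} {v : ℝ × ℝ} {t : ℝ} (hγ : HasDerivAt γ v t) (ht : γ t ∈ Ω) :
    HasDerivAt (fun t => f.1 (γ t)) ((dirDeriv hΩ v f).1 (γ t)) t := by
  rw [dirDeriv_apply hΩ v f ht]
  exact (differentiableAt_of_smoothOn hΩ f ht).hasFDerivAt.comp_hasDerivAt t hγ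

lemma hasDerivAt_dirDeriv_fst {Ω : Set (ℝ × ℝ)} (hΩ : IsOpen Ω) (f : smoothOn Ω) {x y : ℝ}
    (h : (x, y) ∈ Ω) :
    HasDerivAt (fun x => f.1 (x, y)) ((dirDeriv hΩ (1, 0) f).1 (x, y)) x :=
  hasDerivAt_comp_dirDeriv hΩ f ((hasDerivAt_id x).prodMk (hasDerivAt_const x y)) h

lemma hasDerivAt_dirDeriv_snd {Ω : Set (ℝ × ℝ)} (hΩ : IsOpen Ω) (f : smoothOn Ω) {x y : ℝ}
    (h : (x, y) ∈ Ω) :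
    HasDerivAt (fun y => f.1 (x, y)) ((dirDeriv hΩ (0, 1) f).1 (x, y)) y :=
  hasDerivAt_comp_dirDeriv hΩ f ((hasDerivAt_const y x).prodMk (hasDerivAt_id y)) h

lemma hasDerivAt_dirDeriv_diag {Ω : Set (ℝ × ℝ)} (hΩ : IsOpen Ω) (f : smoothOn Ω) {t : ℝ}
    (h : (t, t) ∈ Ω) :
    HasDerivAt (fun t => f.1 (t, t)) ((dirDeriv hΩ (1, 1) f).1 (t, t)) t :=
  hasDerivAt_comp_dirDeriv hΩ f ((hasDerivAt_id t).prodMk (hasDerivAt_id t)) h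

variable {T : ℝ}

lemma isOpen_square (T : ℝ) : IsOpen (Ioo 0 T ×ˢ Ioo 0 T) := isOpen_Ioo.prod isOpen_Ioo

/-- The restriction of `f` to the diagonal vanishes to infinite order at the origin. -/
def IsDiagFlat (f : smoothOn (Ioo 0 T ×ˢ Ioo 0 T)) : Prop :=
  ∀ N : ℕ, ∃ C, ∀ t ∈ Ioo 0 T, |f.1 (t, t)| ≤ C * t ^ N

lemma IsDiagFlat.sub {f g : smoothOn (Ioo 0 T ×ˢ Ioo 0 T)} (hf : IsDiagFlat f)
    (hg : IsDiagFlat g) : IsDiagFlat (f - g) := by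
  intro N
  obtain ⟨C, hC⟩ := hf N
  obtain ⟨C', hC'⟩ := hg N
  refine ⟨C + C', fun t ht => (abs_sub _ _).trans ?_⟩
  rw [add_mul]
  exact add_le_add (hC t ht) (hC' t ht)

lemma IsDiagFlat.isFlat_of_dirDeriv_snd {g : smoothOn (Ioo 0 T ×ˢ Ioo 0 T)} (hg : IsDiagFlat g)
    (hd : IsFlat (dirDeriv (isOpen_square T) (0, 1) g)) : IsFlat g := by
  intro N
  obtain ⟨C, hC⟩ := hg N
  obtain ⟨C', hC'⟩ := hd N
  refine ⟨|C| + |C'| * 2 ^ N * T, ?_⟩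
  rintro ⟨x, y⟩ ⟨⟨hx, hx'⟩, ⟨hy, hy'⟩⟩
  simp only at hx hx' hy hy' ⊢
  have hb : ∀ z, min x y ≤ z → z ≤ max x y →
      |(dirDeriv (isOpen_square T) (0, 1) g).1 (x, z)| ≤ |C'| * 2 ^ N * (x + y) ^ N := by
    intro z h1 h2
    have hz : 0 < z := (lt_min hx hy).trans_le h1
    have hz' : z < T := h2.trans_lt (max_lt hx' hy')
    refine (hC' (x, z) ⟨⟨hx, hx'⟩, ⟨hz, hz'⟩⟩).trans ?_
    rw [mul_assoc, ← mul_pow]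
    have : z ≤ x + y := h2.trans (max_le (by linarith) (by linarith))
    exact mul_le_mul (le_abs_self _) (pow_le_pow_left₀ (by simp; linarith) (by simp; linarith) _)
      (pow_nonneg (by simp; linarith) _) (abs_nonneg _)
  have hsub : |g.1 (x, y) - g.1 (x, x)| ≤ |C'| * 2 ^ N * (x + y) ^ N * T := by
    have hB : 0 ≤ |C'| * 2 ^ N * (x + y) ^ N := by positivity
    rcases le_total x y with h | h
    · refine (abs_sub_le_of_hasDerivAt (f := fun z => g.1 (x, z)) h (fun z hz =>
        hasDerivAt_dirDeriv_snd (isOpen_square T) g ⟨⟨hx, hx'⟩, ⟨hx.trans_le hz.1,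
          hz.2.trans_lt hy'⟩⟩) fun z hz => hb z (by simp [hz.1]) (by simp [hz.2])).trans ?_
      gcongr
      linarith
    · rw [abs_sub_comm]
      refine (abs_sub_le_of_hasDerivAt (f := fun z => g.1 (x, z)) h (fun z hz =>
        hasDerivAt_dirDeriv_snd (isOpen_square T) g ⟨⟨hx, hx'⟩, ⟨hy.trans_le hz.1,
          hz.2.trans_lt hx'⟩⟩) fun z hz => hb z (by simp [hz.1]) (by simp [hz.2])).trans ?_
      gcongr
      linarith
  have h0 : |g.1 (x, x)| ≤ |C| * (x + y) ^ N := by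
    refine (hC x ⟨hx, hx'⟩).trans ?_
    gcongr
    · exact le_abs_self C
    · linarith
  have t := abs_sub_abs_le_abs_sub (g.1 (x, y)) (g.1 (x, x))
  linarith

/-- The Cauchy problem for `∂₁∂₂ u = c u + s` on the diagonal preserves flatness when
`c` has a small singularity at the origin. -/
lemma isFlat_of_isDiagFlat {K : ℝ} (hK : 0 ≤ K) (hKT : K * T ≤ 1 / 2)
    {c u s : smoothOn (Ioo 0 T ×ˢ Ioo 0 T)}
    (hc : ∀ p ∈ Ioo 0 T ×ˢ Ioo 0 T, |c.1 p| ≤ K / (p.1 + p.2)) (hs : IsFlat s)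
    (h : dirDeriv (isOpen_square T) (1, 0) (dirDeriv (isOpen_square T) (0, 1) u) = c * u + s)
    (h0 : IsDiagFlat u) (h1 : IsDiagFlat (dirDeriv (isOpen_square T) (1, 0) u))
    (h2 : IsDiagFlat (dirDeriv (isOpen_square T) (1, 1) u)) : IsFlat u := by
  have h3 : IsDiagFlat (dirDeriv (isOpen_square T) (0, 1) u) := by
    have e : dirDeriv (isOpen_square T) (1, 1) u = dirDeriv (isOpen_square T) (1, 0) u
        + dirDeriv (isOpen_square T) (0, 1) u := by
      rw [← dirDeriv_add]
      simp
    have := h2.sub h1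
    rwa [e, add_sub_cancel_left] at this
  have h' : dirDeriv (isOpen_square T) (0, 1) (dirDeriv (isOpen_square T) (1, 0) u)
      = c * u + s := by
    rw [← h]
    exact dirDeriv_comm _ _ _ u
  intro N
  obtain ⟨C0, hC0⟩ := h0 N
  obtain ⟨C1, hC1⟩ := h1 N
  obtain ⟨C3, hC3⟩ := h3 N
  obtain ⟨Cs, hCs⟩ := hs N
  set A := |C0| + |C1| + |C3| + |Cs| * 2 ^ N with hA
  have hA0 : 0 ≤ A := by positivity
  have hp : 0 ≤ |Cs| * 2 ^ N := by positivity
  have weak : ∀ {C a t : ℝ}, a ≤ C * t ^ N → 0 < t → |C| ≤ A → a ≤ A * t ^ N :=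
    fun ha ht hC => ha.trans (mul_le_mul_of_nonneg_right ((le_abs_self _).trans hC)
      (pow_nonneg ht.le _))
  have hC0A : |C0| ≤ A := by linarith [abs_nonneg C1, abs_nonneg C3]
  have hC1A : |C1| ≤ A := by linarith [abs_nonneg C0, abs_nonneg C3]
  have hC3A : |C3| ≤ A := by linarith [abs_nonneg C1, abs_nonneg C0]
  have rhs : ∀ x ∈ Ioo 0 T, ∀ y ∈ Ioo 0 T, ∀ m, x ≤ m → y ≤ m → (m = x ∨ m = y) →
      |(c * u + s).1 (x, y)| ≤ K / m * |u.1 (x, y)| + A * m ^ N := by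
    intro x hx y hy m hxm hym hm
    have hm0 : 0 < m := hx.1.trans_le hxm
    have hmxy : m ≤ x + y := by
      rcases hm with rfl | rfl
      · linarith [hy.1]
      · linarith [hx.1]
    have e : (c * u + s).1 (x, y) = c.1 (x, y) * u.1 (x, y) + s.1 (x, y) := rfl
    rw [e]
    refine (abs_add_le _ _).trans (add_le_add ?_ ?_)
    · rw [abs_mul]
      refine mul_le_mul_of_nonneg_right ((hc _ ⟨hx, hy⟩).trans ?_) (abs_nonneg _)
      simp only
      gcongr
    · refine (hCs _ ⟨hx, hy⟩).trans ?_
      simp only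
      have hxy : 0 ≤ x + y := by linarith [hx.1, hy.1]
      calc Cs * (x + y) ^ N ≤ |Cs| * (2 * m) ^ N := by
            gcongr
            · exact le_abs_self _
            · linarith
        _ = (|Cs| * 2 ^ N) * m ^ N := by rw [mul_pow]; ring
        _ ≤ _ := by
            gcongr
            linarith [abs_nonneg C0, abs_nonneg C1, abs_nonneg C3]
  have bound : ∀ x ∈ Ioo 0 T, ∀ y ∈ Ioo 0 T, ∀ m, x ≤ m → y ≤ m → (m = x ∨ m = y) →
      |u.1 (x, y)| ≤ 2 * A * (1 + T + T ^ 2) * m ^ N := by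
    intro x hx y hy m hxm hym hm
    rcases hm with rfl | rfl
    · refine abs_le_of_characteristic (u := fun a b => u.1 (b, a))
        (v := fun a b => (dirDeriv (isOpen_square T) (1, 0) u).1 (b, a))
        (r := fun a b => (c * u + s).1 (b, a)) hA0 hK hKT ?_ ?_ ?_ ?_ ?_ ?_ hy.1 hym hx.2
      · exact u.2.continuousOn.comp continuous_swap.continuousOn fun p hp => ⟨hp.2, hp.1⟩
      · exact fun a ha b hb => hasDerivAt_dirDeriv_fst _ u ⟨hb, ha⟩
      · intro a ha b hb
        rw [← h']
        exact hasDerivAt_dirDeriv_snd _ _ ⟨hb, ha⟩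
      · exact fun a ha b hb hab => rhs b hb a ha b le_rfl hab (.inl rfl)
      · exact fun a ha => weak (hC0 a ha) ha.1 hC0A
      · exact fun a ha => weak (hC1 a ha) ha.1 hC1A
    · refine abs_le_of_characteristic (u := fun a b => u.1 (a, b))
        (v := fun a b => (dirDeriv (isOpen_square T) (0, 1) u).1 (a, b))
        (r := fun a b => (c * u + s).1 (a, b)) hA0 hK hKT ?_ ?_ ?_ ?_ ?_ ?_ hx.1 hxm hy.2
      · exact u.2.continuousOn
      · exact fun a ha b hb => hasDerivAt_dirDeriv_snd _ u ⟨ha, hb⟩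
      · intro a ha b hb
        rw [← h]
        exact hasDerivAt_dirDeriv_fst _ _ ⟨ha, hb⟩
      · exact fun a ha b hb hab => rhs a ha b hb b hab le_rfl (.inr rfl)
      · exact fun a ha => weak (hC0 a ha) ha.1 hC0A
      · exact fun a ha => weak (hC3 a ha) ha.1 hC3A
  refine ⟨2 * A * (1 + T + T ^ 2), ?_⟩
  rintro ⟨x, y⟩ ⟨hx, hy⟩
  refine (bound x hx y hy (max x y) (le_max_left _ _) (le_max_right _ _) (max_choice x y)).trans ?_
  have hT : 0 < T := hx.1.trans hx.2
  have hm : 0 ≤ max x y := hx.1.le.trans (le_max_left _ _)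
  have hx1 := hx.1
  have hy1 := hy.1
  simp only at hx1 hy1 ⊢
  gcongr
  exact max_le (by linarith) (by linarith)

end DiagFlat

section Coefficient

namespace AllDerivs

lemma flatMultiplier_of_chain {Ω : Set (ℝ × ℝ)} {hΩ : IsOpen Ω} {z : smoothOn Ω}
    {b : ℕ → smoothOn Ω} (hz : ∀ n, AllDerivs hΩ IsFlatMultiplier n z)
    (hb : ∀ k, ∃ C, ∀ p ∈ Ω, |(b k).1 p| ≤ C)
    (hd : ∀ k v, EqOn (dirDeriv hΩ v (b k)).1 (b (k + 1) * dirDeriv hΩ v z).1 Ω) (n k : ℕ) :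
    AllDerivs hΩ IsFlatMultiplier n (b k) := by
  have hbk : ∀ k, IsFlatMultiplier (b k) := fun k =>
    (hb k).elim fun C hC => IsFlatMultiplier.of_bounded hC
  induction n generalizing k with
  | zero => exact hbk k
  | succ n ih =>
    exact ⟨hbk k, fun v =>
      ((ih (k + 1)).flatMultiplier_mul ((hz (n + 1)).2 v)).flatMultiplier_congr (hd k v)⟩

lemma flatMultiplier_clm {Ω : Set (ℝ × ℝ)} {hΩ : IsOpen Ω} {x : smoothOn Ω}
    (l : ℝ × ℝ →L[ℝ] ℝ) (hx : EqOn x.1 l Ω) {C : ℝ} (hC : ∀ p ∈ Ω, ‖p‖ ≤ C) (n : ℕ) :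
    AllDerivs hΩ IsFlatMultiplier n x := by
  have hx' : IsFlatMultiplier x := IsFlatMultiplier.of_bounded (B := ‖l‖ * C) fun p hp => by
    rw [hx hp]
    exact (l.le_opNorm p).trans (mul_le_mul_of_nonneg_left (hC p hp) (norm_nonneg _))
  cases n with
  | zero => exact hx'
  | succ n =>
    refine ⟨hx', fun v => (flatMultiplier_const (l v)).flatMultiplier_congr fun p hp => ?_⟩
    rw [dirDeriv_apply hΩ v x hp, (hx.eventuallyEq_of_mem (hΩ.mem_nhds hp)).fderiv_eq, l.fderiv]
    rfl

lemma flatMultiplier_inv_add {Ω : Set (ℝ × ℝ)} {hΩ : IsOpen Ω} {r : smoothOn Ω}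
    (hr : ∀ p ∈ Ω, r.1 p = (p.1 + p.2)⁻¹) (hpos : ∀ p ∈ Ω, 0 < p.1 + p.2) (n : ℕ) :
    AllDerivs hΩ IsFlatMultiplier n r := by
  have h0 : IsFlatMultiplier r := by
    intro f hf N
    obtain ⟨C, hC⟩ := hf (N + 1)
    refine ⟨C, fun p hp => ?_⟩
    change |r.1 p * f.1 p| ≤ _
    have := hpos p hp
    rw [hr p hp, abs_mul, abs_of_pos (inv_pos.2 this), inv_mul_le_iff₀ this]
    exact (hC p hp).trans_eq (by ring)
  induction n with
  | zero => exact h0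
  | succ n ih =>
    refine ⟨h0, fun v => ((flatMultiplier_const (-(v.1 + v.2))).flatMultiplier_mul
      (ih.flatMultiplier_mul ih)).flatMultiplier_congr fun p hp => ?_⟩
    rw [dirDeriv_apply hΩ v r hp,
      (Filter.eventuallyEq_of_mem (hΩ.mem_nhds hp) hr : r.1 =ᶠ[nhds p] _).fderiv_eq]
    have hs : HasFDerivAt (fun p : ℝ × ℝ => p.1 + p.2)
        (ContinuousLinearMap.fst ℝ ℝ ℝ + ContinuousLinearMap.snd ℝ ℝ ℝ) p :=
      hasFDerivAt_fst.add hasFDerivAt_snd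
    have h : HasFDerivAt (fun p : ℝ × ℝ => (p.1 + p.2)⁻¹) _ p :=
      (hasDerivAt_inv (hpos p hp).ne').comp_hasFDerivAt p hs
    rw [h.fderiv]
    change _ = -(v.1 + v.2) * (r.1 p * r.1 p)
    rw [hr p hp]
    simp
    field_simp
    ring

end AllDerivs

lemma harmonic_mem_Ioc {T x y : ℝ} (hx : x ∈ Ioo 0 T) (hy : y ∈ Ioo 0 T) :
    2 * x * y / (x + y) ∈ Ioc 0 T ∧ 2 * x * y / (x + y) ≤ x + y := by
  obtain ⟨hx0, hxT⟩ := hx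
  obtain ⟨hy0, hyT⟩ := hy
  refine ⟨⟨by positivity, ?_⟩, ?_⟩
  · rw [div_le_iff₀ (by positivity)]
    nlinarith
  · rw [div_le_iff₀ (by positivity)]
    nlinarith [sq_nonneg (x - y)]

lemma exists_flatMultiplier_coefficient {ε : ℝ} {B : ℝ → ℝ} (hε : 0 < ε)
    (hB : ContDiffOn ℝ (⊤ : ℕ∞) B (Ico 0 ε)) :
    ∃ K, 0 ≤ K ∧ ∀ T, T ≤ ε / 2 → ∃ c : smoothOn (Ioo 0 T ×ˢ Ioo 0 T),
      (∀ p ∈ Ioo 0 T ×ˢ Ioo 0 T, (p.1 + p.2) ^ 2 * c.1 p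
        = (2 * p.1 * p.2 / (p.1 + p.2)) * B (2 * p.1 * p.2 / (p.1 + p.2))) ∧
      (∀ p ∉ Ioo 0 T ×ˢ Ioo 0 T, c.1 p = 0) ∧
      (∀ p ∈ Ioo 0 T ×ˢ Ioo 0 T, |c.1 p| ≤ K / (p.1 + p.2)) ∧
      ∀ n, AllDerivs (isOpen_square T) IsFlatMultiplier n c := by
  have hu : UniqueDiffOn ℝ (Ico 0 ε) := uniqueDiffOn_Ico 0 ε
  have hsm : ∀ k, ContDiffOn ℝ (⊤ : ℕ∞) (iteratedDerivWithin k B (Ico 0 ε)) (Ico 0 ε) := fun k => by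
    induction k with
    | zero => simpa using hB
    | succ k ih =>
      exact (ih.derivWithin hu (by simp)).congr fun t _ => by rw [iteratedDerivWithin_succ]
  have hbd : ∀ k, ∃ C, ∀ t ∈ Icc 0 (ε / 2), |iteratedDerivWithin k B (Ico 0 ε) t| ≤ C := fun k =>
    isCompact_Icc.exists_bound_of_continuousOn
      ((hsm k).continuousOn.mono fun t ht => ⟨ht.1, by linarith [ht.2]⟩)
  have hder : ∀ k, ∀ t ∈ Ioo 0 ε, HasDerivAt (iteratedDerivWithin k B (Ico 0 ε))
      (iteratedDerivWithin (k + 1) B (Ico 0 ε) t) t := fun k t ht => by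
    have hn : Ico 0 ε ∈ nhds t := Ico_mem_nhds ht.1 ht.2
    rw [iteratedDerivWithin_succ, derivWithin_of_mem_nhds hn]
    exact (((hsm k).contDiffAt hn).differentiableAt (by simp)).hasDerivAt
  obtain ⟨K, hK⟩ := hbd 0
  simp only [iteratedDerivWithin_zero] at hK
  refine ⟨K, (abs_nonneg _).trans (hK 0 (by simp; positivity)), fun T hT => ?_⟩
  have hΩ := isOpen_square T
  have hpos : ∀ p ∈ Ioo 0 T ×ˢ Ioo 0 T, 0 < p.1 + p.2 := fun p hp => add_pos hp.1.1 hp.2.1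
  have hnorm : ∀ p ∈ Ioo 0 T ×ˢ Ioo 0 T, ‖p‖ ≤ T := fun p hp =>
    norm_prod_le_iff.2 ⟨by rw [Real.norm_of_nonneg hp.1.1.le]; exact hp.1.2.le,
      by rw [Real.norm_of_nonneg hp.2.1.le]; exact hp.2.2.le⟩
  let x : smoothOn (Ioo 0 T ×ˢ Ioo 0 T) := ⟨Prod.fst, contDiffOn_fst⟩
  let y : smoothOn (Ioo 0 T ×ˢ Ioo 0 T) := ⟨Prod.snd, contDiffOn_snd⟩
  let r : smoothOn (Ioo 0 T ×ˢ Ioo 0 T) := ⟨fun p => (p.1 + p.2)⁻¹,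
    (contDiffOn_fst.add contDiffOn_snd).inv fun p hp => (hpos p hp).ne'⟩
  let z : smoothOn (Ioo 0 T ×ˢ Ioo 0 T) := algebraMap ℝ _ 2 * x * y * r
  have hx : ∀ n, AllDerivs hΩ IsFlatMultiplier n x :=
    AllDerivs.flatMultiplier_clm (.fst ℝ ℝ ℝ) (fun _ _ => rfl) hnorm
  have hy : ∀ n, AllDerivs hΩ IsFlatMultiplier n y :=
    AllDerivs.flatMultiplier_clm (.snd ℝ ℝ ℝ) (fun _ _ => rfl) hnorm
  have hr : ∀ n, AllDerivs hΩ IsFlatMultiplier n r :=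
    AllDerivs.flatMultiplier_inv_add (fun _ _ => rfl) hpos
  have hz : ∀ n, AllDerivs hΩ IsFlatMultiplier n z := fun n =>
    (((AllDerivs.flatMultiplier_const 2).flatMultiplier_mul (hx n)).flatMultiplier_mul
      (hy n)).flatMultiplier_mul (hr n)
  have hzv : ∀ p, z.1 p = 2 * p.1 * p.2 / (p.1 + p.2) := fun p => rfl
  have hzm : ∀ p ∈ Ioo 0 T ×ˢ Ioo 0 T, z.1 p ∈ Ioc 0 T := fun p hp =>
    (harmonic_mem_Ioc hp.1 hp.2).1
  let b : ℕ → smoothOn (Ioo 0 T ×ˢ Ioo 0 T) := fun k =>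
    ⟨fun p => iteratedDerivWithin k B (Ico 0 ε) (z.1 p), (hsm k).comp z.2 fun p hp =>
      ⟨(hzm p hp).1.le, by linarith [(hzm p hp).2]⟩⟩
  have hb : ∀ n, AllDerivs hΩ IsFlatMultiplier n (b 0) := fun n => by
    refine AllDerivs.flatMultiplier_of_chain hz (fun k => (hbd k).imp fun C hC p hp =>
      hC _ ⟨(hzm p hp).1.le, (hzm p hp).2.trans hT⟩) (fun k v p hp => ?_) n 0
    rw [dirDeriv_apply hΩ v _ hp]
    change _ = (b (k + 1)).1 p * (dirDeriv hΩ v z).1 p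
    rw [dirDeriv_apply hΩ v _ hp]
    have hzp := hzm p hp
    have := (hder k (z.1 p) ⟨hzp.1, by linarith [hzp.2]⟩).comp_hasFDerivAt p
      (differentiableAt_of_smoothOn hΩ z hp).hasFDerivAt
    exact congrArg (fun l => l v) this.fderiv
  have hc : ∀ n, AllDerivs hΩ IsFlatMultiplier n (z * b 0 * r * r) := fun n =>
    (((hz n).flatMultiplier_mul (hb n)).flatMultiplier_mul (hr n)).flatMultiplier_mul (hr n)
  have hcv : ∀ p, (z * b 0 * r * r).1 p = z.1 p * B (z.1 p) * (p.1 + p.2)⁻¹ * (p.1 + p.2)⁻¹ := by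
    intro p
    change z.1 p * iteratedDerivWithin 0 B (Ico 0 ε) (z.1 p) * _ * _ = _
    rw [iteratedDerivWithin_zero]
  have hind : EqOn ((Ioo 0 T ×ˢ Ioo 0 T).indicator (z * b 0 * r * r).1) (z * b 0 * r * r).1
      (Ioo 0 T ×ˢ Ioo 0 T) := fun p hp => indicator_of_mem hp _
  refine ⟨⟨_, (z * b 0 * r * r).2.congr hind⟩, fun p hp => ?_,
    fun p hp => indicator_of_notMem hp _, fun p hp => ?_,
    fun n => (hc n).flatMultiplier_congr hind⟩
  · simp only
    rw [hind hp, hcv, ← hzv]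
    have := (hpos p hp).ne'
    field_simp
  · simp only
    have h0 := hpos p hp
    have hzp := hzm p hp
    have hBz := hK _ ⟨hzp.1.le, hzp.2.trans hT⟩
    rw [hind hp, hcv, abs_mul, abs_mul, abs_mul, abs_of_pos hzp.1, abs_of_pos (inv_pos.2 h0)]
    have hle : z.1 p ≤ p.1 + p.2 := (harmonic_mem_Ioc hp.1 hp.2).2
    calc _ ≤ (p.1 + p.2) * K * (p.1 + p.2)⁻¹ * (p.1 + p.2)⁻¹ := by gcongr
      _ = _ := by field_simp

end Coefficient

lemma exists_abs_le_mul_pow_of_iteratedDeriv_eq_zero {Q : ℝ → ℝ} (hQ : ContDiff ℝ (⊤ : ℕ∞) Q)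
    (h : ∀ i, iteratedDeriv i Q 0 = 0) (T : ℝ) (N : ℕ) :
    ∃ C, ∀ t ∈ Icc 0 T, |Q t| ≤ C * t ^ N := by
  induction N generalizing Q with
  | zero =>
    obtain ⟨C, hC⟩ := isCompact_Icc.exists_bound_of_continuousOn
      (hQ.continuous.continuousOn (s := Icc 0 T))
    exact ⟨C, fun t ht => by simpa using hC t ht⟩
  | succ N ih =>
    have hQd : ContDiff ℝ (⊤ : ℕ∞) (deriv Q) := (contDiff_infty_iff_deriv.1 hQ).2
    obtain ⟨C, hC⟩ := ih hQd fun i => by rw [← iteratedDeriv_succ']; exact h (i + 1)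
    refine ⟨|C|, fun t ht => ?_⟩
    have h0 : Q 0 = 0 := by simpa using h 0
    have := abs_sub_le_of_hasDerivAt (f := Q) (C := |C| * t ^ N) ht.1
      (fun s _ => ((hQ.differentiable (by simp)) s).hasDerivAt) fun s hs => by
        refine (hC s ⟨hs.1, hs.2.trans ht.2⟩).trans ?_
        have := hs.1
        gcongr
        · exact le_abs_self C
        · exact hs.2
    rw [h0, sub_zero, sub_zero] at this
    rwa [pow_succ, ← mul_assoc]

lemma isDiagFlat_iterate {T : ℝ} {f : smoothOn (Ioo 0 T ×ˢ Ioo 0 T)} {Q : ℝ → ℝ}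
    (hQ : ContDiff ℝ (⊤ : ℕ∞) Q) (h : ∀ i, iteratedDeriv i Q 0 = 0)
    (hf : ∀ t ∈ Ioo 0 T, Q t = f.1 (t, t)) (k : ℕ) :
    IsDiagFlat ((dirDeriv (isOpen_square T) (1, 1))^[k] f) := by
  induction k generalizing f Q with
  | zero =>
    intro N
    obtain ⟨C, hC⟩ := exists_abs_le_mul_pow_of_iteratedDeriv_eq_zero hQ h T N
    refine ⟨C, fun t ht => ?_⟩
    rw [Function.iterate_zero_apply, ← hf t ht]
    exact hC t (Ioo_subset_Icc_self ht)
  | succ k ih =>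
    rw [Function.iterate_succ_apply]
    refine ih (contDiff_infty_iff_deriv.1 hQ).2
      (fun i => by rw [← iteratedDeriv_succ']; exact h (i + 1)) fun t ht => ?_
    rw [(Filter.eventuallyEq_of_mem (Ioo_mem_nhds ht.1 ht.2) hf).deriv_eq]
    exact (hasDerivAt_dirDeriv_diag (isOpen_square T) f ⟨ht, ht⟩).deriv

lemma bddFamily_of_isFlat {Ω : Set (ℝ × ℝ)} (hΩ : IsOpen Ω) {w : smoothOn Ω}
    (h : ∀ i j, IsFlat ((dirDeriv hΩ (1, 0))^[i] ((dirDeriv hΩ (0, 1))^[j] w))) :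
    BddFamily Ω fun i j => ((dirDeriv hΩ (1, 0))^[i] ((dirDeriv hΩ (0, 1))^[j] w)).1 where
  hasFDerivAt i j p hp := by
    rw [Function.iterate_succ_apply', Function.iterate_succ_apply',
      ← (dirDeriv_comm hΩ (0, 1) (1, 0)).iterate_right i, dirDeriv_apply hΩ _ _ hp,
      dirDeriv_apply hΩ _ _ hp]
    exact (differentiableAt_of_smoothOn hΩ _ hp).hasFDerivAt.congr_fderiv (by ext <;> simp)
  bounded i j := (h i j 0).imp fun C hC p hp => by simpa using hC p hp

/-- there exists `T₀ ∈ (0,ε/2]` depending only on `B₁` such that for `0 < T ≤ T₀`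
and every smooth solution `w` of `(μ+ν)² ∂_μ∂_ν w = (2μν/(μ+ν)) B₁(2μν/(μ+ν)) w` on
`(0,T)×(0,T)` whose diagonal traces `q₁(μ) = w(μ,μ)` and `q₂(μ) = (∂_μ w)(μ,μ)` extend to
`C^∞` functions on `[0,T]` all of whose derivatives vanish at `μ = 0`, the solution `w`
extends to a `C^∞` function on a neighborhood of the closed square `[0,T]×[0,T]`. -/
theorem stmt6 (ε : ℝ) (hε : 0 < ε) (B₁ : ℝ → ℝ) (hB₁ : ContDiffOn ℝ (⊤ : ℕ∞) B₁ (Ico 0 ε)) :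
    ∃ T₀ : ℝ, 0 < T₀ ∧ T₀ ≤ ε / 2 ∧
      ∀ T : ℝ, 0 < T → T ≤ T₀ →
      ∀ w : ℝ → ℝ → ℝ,
        ContDiffOn ℝ (⊤ : ℕ∞) (fun p : ℝ × ℝ => w p.1 p.2) (Ioo 0 T ×ˢ Ioo 0 T) →
        (∀ μ ∈ Ioo (0 : ℝ) T, ∀ ν ∈ Ioo (0 : ℝ) T,
          (μ + ν) ^ 2 * deriv (fun a => deriv (fun b => w a b) ν) μ
            = (2 * μ * ν / (μ + ν)) * B₁ (2 * μ * ν / (μ + ν)) * w μ ν) →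
        (∃ Q₁ : ℝ → ℝ, ContDiff ℝ (⊤ : ℕ∞) Q₁ ∧ (∀ μ ∈ Ioo (0 : ℝ) T, Q₁ μ = w μ μ) ∧
          ∀ i : ℕ, iteratedDeriv i Q₁ 0 = 0) →
        (∃ Q₂ : ℝ → ℝ, ContDiff ℝ (⊤ : ℕ∞) Q₂ ∧
          (∀ μ ∈ Ioo (0 : ℝ) T, Q₂ μ = deriv (fun a => w a μ) μ) ∧
          ∀ i : ℕ, iteratedDeriv i Q₂ 0 = 0) →
        ∃ U : Set (ℝ × ℝ), IsOpen U ∧ Icc (0 : ℝ) T ×ˢ Icc (0 : ℝ) T ⊆ U ∧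
          ∃ W : ℝ × ℝ → ℝ, ContDiffOn ℝ (⊤ : ℕ∞) W U ∧
            ∀ μ ∈ Ioo (0 : ℝ) T, ∀ ν ∈ Ioo (0 : ℝ) T, W (μ, ν) = w μ ν := by
  obtain ⟨K, hK, hcoef⟩ := exists_flatMultiplier_coefficient hε hB₁
  refine ⟨min (ε / 2) (1 / (2 * (K + 1))), by positivity, min_le_left _ _, ?_⟩
  rintro T hT hT₀ w hw heq ⟨Q₁, hQ₁, hQ₁w, hQ₁0⟩ ⟨Q₂, hQ₂, hQ₂w, hQ₂0⟩
  have hKT : K * T ≤ 1 / 2 := by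
    have h1 : T ≤ 1 / (2 * (K + 1)) := hT₀.trans (min_le_right _ _)
    rw [le_div_iff₀ (by positivity)] at h1
    nlinarith
  obtain ⟨c, hc, hc0, hcK, hcm⟩ := hcoef T (hT₀.trans (min_le_left _ _))
  have hΩ := isOpen_square T
  let f : smoothOn (Ioo 0 T ×ˢ Ioo 0 T) := ⟨fun p => w p.1 p.2, hw⟩
  have hf : dirDeriv hΩ (1, 0) (dirDeriv hΩ (0, 1) f) = c * f := by
    ext p
    change _ = c.1 p * w p.1 p.2
    by_cases hp : p ∈ Ioo 0 T ×ˢ Ioo 0 T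
    · have hxy : 0 < p.1 + p.2 := add_pos hp.1.1 hp.2.1
      have h := heq p.1 hp.1 p.2 hp.2
      have he : (fun a => deriv (fun b => w a b) p.2) =ᶠ[nhds p.1]
          fun a => (dirDeriv hΩ (0, 1) f).1 (a, p.2) :=
        Filter.eventually_of_mem (Ioo_mem_nhds hp.1.1 hp.1.2) fun a ha =>
          (hasDerivAt_dirDeriv_snd hΩ f ⟨ha, hp.2⟩).deriv
      rw [he.deriv_eq, (hasDerivAt_dirDeriv_fst hΩ _ hp).deriv, ← hc p hp, mul_assoc] at h
      exact mul_left_cancel₀ (by positivity) h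
    · rw [hc0 p hp, zero_mul, dirDeriv_apply_of_notMem hΩ _ _ hp]
  have hflat := isFlat_iterate_iterate hcm hf IsDiagFlat
    (fun u s hs h h0 h1 h2 => by
      have hu := isFlat_of_isDiagFlat hK hKT hcK hs h h0 h1 h2
      refine ⟨hu, h1.isFlat_of_dirDeriv_snd ?_⟩
      rw [dirDeriv_comm hΩ (0, 1) (1, 0) u, h]
      exact (hcm 0 u hu).add hs)
    (isDiagFlat_iterate hQ₁ hQ₁0 fun t ht => hQ₁w t ht)
    (isDiagFlat_iterate hQ₂ hQ₂0 fun t ht => by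
      rw [hQ₂w t ht]
      exact (hasDerivAt_dirDeriv_fst hΩ f ⟨ht, ht⟩).deriv)
  obtain ⟨W, hW, hWf⟩ := (bddFamily_of_isFlat hΩ hflat).exists_contDiff_extension hT
  exact ⟨univ, isOpen_univ, subset_univ _, W, hW.contDiffOn,
    fun μ hμ ν hν => hWf (μ, ν) ⟨hμ, hν⟩⟩
end

section
/- Let ε > 0, let φ and B be C^∞ functions on [0,ε), let λ ≥ 0 and c₀ > 0, and assume φ(x) > 0 and λφ(x) + B(x) ≥ c₀ for all x ∈ [0,ε). There exist T₀ ∈ (0, ε/2] and C > 0, depending only on φ, B, λ, c₀, with the following property. Let 0 < T ≤ T₀, let G be measurable on Ω_T = (0,T)×(0,T) with |||G|||_{0,2} < ∞, and let W be a C^∞ function on Ω_T satisfying (μ+ν)² ∂_μ∂_ν W − (λ φ(2μν/(μ+ν)) + B(2μν/(μ+ν))) W = G on Ω_T, whose diagonal traces q₁(μ) = W(μ,μ) and q₂(μ) = (∂_μ W)(μ,μ) satisfy ‖q₁‖_{1,1} < ∞ and ‖q₂‖_{1,1} < ∞. Then for every fixed μ ∈ (0,T), ∫_0^T [ (∂_ν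 W(μ,ν))² + (μ+ν)^{-2} (λ+1) W(μ,ν)² ] dν ≤ C (‖q₁‖_{1,1}² + ‖q₂‖_{1,1}² + |||G|||_{0,2}²), and for every fixed ν ∈ (0,T), ∫_0^T [ (∂_μ W(μ,ν))² + (μ+ν)^{-2} (λ+1) W(μ,ν)² ] dμ ≤ C (‖q₁‖_{1,1}² + ‖q₂‖_{1,1}² + |||G|||_{0,2}²). -/
open MeasureTheory Set ENNReal

/-- The weighted Sobolev norm squared
`‖q‖_{s,j}² = Σ_{i=0}^{s} ∫_0^T |(d/dμ)^i (μ^{-j} q(μ))|² dμ`, valued in `[0,∞]`. -/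
noncomputable def sobNormSq (T : ℝ) (s : ℕ) (j : ℝ) (q : ℝ → ℝ) : ℝ≥0∞ :=
  ∑ i ∈ Finset.range (s + 1),
    ∫⁻ μ in Ioo (0 : ℝ) T, ENNReal.ofReal ((iteratedDeriv i (fun t => t ^ (-j) * q t) μ) ^ 2)

/-- The weighted norm squared `|||G|||_{0,j}² = ∫_{Ω_T} (μ+ν)^{-2j} G(μ,ν)² dμ dν`,
valued in `[0,∞]`. -/
noncomputable def srcNormSq (T : ℝ) (j : ℝ) (G : ℝ → ℝ → ℝ) : ℝ≥0∞ :=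
  ∫⁻ p in Ioo (0 : ℝ) T ×ˢ Ioo (0 : ℝ) T,
    ENNReal.ofReal ((p.1 + p.2) ^ (-(2 * j)) * (G p.1 p.2) ^ 2)

/-- Fubini on the triangle `n < y ≤ x ≤ m`. -/
lemma triangle_fubini {n m : ℝ} (hnm : n ≤ m) {g : ℝ → ℝ → ℝ}
    (hg : ContinuousOn (fun p : ℝ × ℝ => g p.1 p.2) (Icc n m ×ˢ Icc n m)) :
    IntervalIntegrable (fun x => ∫ y in n..x, g x y) volume n m ∧
    IntervalIntegrable (fun y => ∫ x in y..m, g x y) volume n m ∧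
    ∫ x in n..m, ∫ y in n..x, g x y = ∫ y in n..m, ∫ x in y..m, g x y := by
  set D : Set (ℝ × ℝ) := (Ioc n m ×ˢ Ioc n m) ∩ {p | p.2 ≤ p.1}
  have hD : MeasurableSet D :=
    (measurableSet_Ioc.prod measurableSet_Ioc).inter (measurableSet_le measurable_snd measurable_fst)
  set g' : ℝ → ℝ → ℝ := fun x y => D.indicator (fun p : ℝ × ℝ => g p.1 p.2) (x, y)
  have hint : Integrable (Function.uncurry g') (volume.prod volume) := by
    have h1 : IntegrableOn (fun p : ℝ × ℝ => g p.1 p.2) (Icc n m ×ˢ Icc n m)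
        (volume.prod volume) :=
      hg.integrableOn_compact (isCompact_Icc.prod isCompact_Icc)
    have h2 := (h1.mono_set (show D ⊆ _ from fun p hp =>
      ⟨Ioc_subset_Icc_self hp.1.1, Ioc_subset_Icc_self hp.1.2⟩)).integrable_indicator hD
    exact h2
  have hx : (fun x => ∫ y, g' x y) = (Ioc n m).indicator (fun x => ∫ y in n..x, g x y) := by
    funext x
    by_cases hx : x ∈ Ioc n m
    · have : g' x = (Ioc n x).indicator (g x) := by
        funext y
        have : (x, y) ∈ D ↔ y ∈ Ioc n x := by
          simp only [D, mem_inter_iff, mem_prod, mem_Ioc, mem_ofPred_eq] at hx ⊢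
          constructor
          · rintro ⟨⟨-, h, -⟩, h'⟩; exact ⟨h, h'⟩
          · rintro ⟨h, h'⟩; exact ⟨⟨hx, h, h'.trans hx.2⟩, h'⟩
        by_cases h : (x, y) ∈ D
        · simp only [g', indicator_of_mem h, indicator_of_mem (this.1 h)]
        · simp only [g', indicator_of_notMem h, indicator_of_notMem (fun h' => h (this.2 h'))]
      rw [indicator_of_mem hx, intervalIntegral.integral_of_le hx.1.le, this,
        integral_indicator measurableSet_Ioc]
    · have : g' x = 0 := by
        funext y
        exact indicator_of_notMem (fun h => hx h.1.1) _
      rw [indicator_of_notMem hx, this]; simp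
  have hy : (fun y => ∫ x, g' x y) = (Ioc n m).indicator (fun y => ∫ x in y..m, g x y) := by
    funext y
    by_cases hy : y ∈ Ioc n m
    · have : (fun x => g' x y) = (Icc y m).indicator (fun x => g x y) := by
        funext x
        have : (x, y) ∈ D ↔ x ∈ Icc y m := by
          simp only [D, mem_inter_iff, mem_prod, mem_Ioc, mem_ofPred_eq, mem_Icc] at hy ⊢
          constructor
          · rintro ⟨⟨⟨-, h⟩, -⟩, h'⟩; exact ⟨h', h⟩
          · rintro ⟨h, h'⟩; exact ⟨⟨⟨hy.1.trans_le h, h'⟩, hy⟩, h⟩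
        by_cases h : (x, y) ∈ D
        · simp only [g', indicator_of_mem h, indicator_of_mem (this.1 h)]
        · simp only [g', indicator_of_notMem h, indicator_of_notMem (fun h' => h (this.2 h'))]
      rw [indicator_of_mem hy, intervalIntegral.integral_of_le hy.2, this,
        integral_indicator measurableSet_Icc, integral_Icc_eq_integral_Ioc]
    · have : (fun x => g' x y) = 0 := by
        funext x
        exact indicator_of_notMem (fun h => hy h.1.2) _
      rw [indicator_of_notMem hy, this]; simp
  refine ⟨?_, ?_, ?_⟩
  · rw [intervalIntegrable_iff_integrableOn_Ioc_of_le hnm,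
      ← integrable_indicator_iff measurableSet_Ioc, ← hx]
    exact hint.integral_prod_left
  · rw [intervalIntegrable_iff_integrableOn_Ioc_of_le hnm,
      ← integrable_indicator_iff measurableSet_Ioc, ← hy]
    exact hint.integral_prod_right
  · rw [intervalIntegral.integral_of_le hnm, intervalIntegral.integral_of_le hnm,
      ← integral_indicator measurableSet_Ioc, ← integral_indicator measurableSet_Ioc, ← hx, ← hy]
    exact integral_integral_swap hint

/-- `U`, `V`, `Z` are the derivatives `W_μ`, `W_ν`, `W_μν` on the square `(0,T)²`, and `h₁`, `h₂`
those of the potential `h`, whose derivative in the time direction `μ - ν` is at most `K h`. -/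
structure WaveData (T K : ℝ) (W U V Z h h₁ h₂ : ℝ → ℝ → ℝ) : Prop where
  contW : ContinuousOn (fun p : ℝ × ℝ => W p.1 p.2) (Ioo 0 T ×ˢ Ioo 0 T)
  contU : ContinuousOn (fun p : ℝ × ℝ => U p.1 p.2) (Ioo 0 T ×ˢ Ioo 0 T)
  contV : ContinuousOn (fun p : ℝ × ℝ => V p.1 p.2) (Ioo 0 T ×ˢ Ioo 0 T)
  contZ : ContinuousOn (fun p : ℝ × ℝ => Z p.1 p.2) (Ioo 0 T ×ˢ Ioo 0 T)
  conth : ContinuousOn (fun p : ℝ × ℝ => h p.1 p.2) (Ioo 0 T ×ˢ Ioo 0 T)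
  conth₁ : ContinuousOn (fun p : ℝ × ℝ => h₁ p.1 p.2) (Ioo 0 T ×ˢ Ioo 0 T)
  conth₂ : ContinuousOn (fun p : ℝ × ℝ => h₂ p.1 p.2) (Ioo 0 T ×ˢ Ioo 0 T)
  derivW₁ : ∀ x ∈ Ioo 0 T, ∀ y ∈ Ioo 0 T, HasDerivAt (fun a => W a y) (U x y) x
  derivW₂ : ∀ x ∈ Ioo 0 T, ∀ y ∈ Ioo 0 T, HasDerivAt (fun b => W x b) (V x y) y
  derivU₂ : ∀ x ∈ Ioo 0 T, ∀ y ∈ Ioo 0 T, HasDerivAt (fun b => U x b) (Z x y) y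
  derivV₁ : ∀ x ∈ Ioo 0 T, ∀ y ∈ Ioo 0 T, HasDerivAt (fun a => V a y) (Z x y) x
  derivh₁ : ∀ x ∈ Ioo 0 T, ∀ y ∈ Ioo 0 T, HasDerivAt (fun a => h a y) (h₁ x y) x
  derivh₂ : ∀ x ∈ Ioo 0 T, ∀ y ∈ Ioo 0 T, HasDerivAt (fun b => h x b) (h₂ x y) y
  h_nonneg : ∀ x ∈ Ioo 0 T, ∀ y ∈ Ioo 0 T, 0 ≤ h x y
  h_time : ∀ x ∈ Ioo 0 T, ∀ y ∈ Ioo 0 T, |h₁ x y - h₂ x y| ≤ K * h x y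

lemma WaveData.swap {T K : ℝ} {W U V Z h h₁ h₂ : ℝ → ℝ → ℝ}
    (H : WaveData T K W U V Z h h₁ h₂) :
    WaveData T K (fun x y => W y x) (fun x y => V y x) (fun x y => U y x) (fun x y => Z y x)
      (fun x y => h y x) (fun x y => h₂ y x) (fun x y => h₁ y x) := by
  have key : ∀ {g : ℝ → ℝ → ℝ},
      ContinuousOn (fun p : ℝ × ℝ => g p.1 p.2) (Ioo 0 T ×ˢ Ioo 0 T) →
      ContinuousOn (fun p : ℝ × ℝ => g p.2 p.1) (Ioo 0 T ×ˢ Ioo 0 T) := fun hg =>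
    hg.comp continuous_swap.continuousOn fun p hp => ⟨hp.2, hp.1⟩
  exact
  { contW := key H.contW
    contU := key H.contV
    contV := key H.contU
    contZ := key H.contZ
    conth := key H.conth
    conth₁ := key H.conth₂
    conth₂ := key H.conth₁
    derivW₁ := fun x hx y hy => H.derivW₂ y hy x hx
    derivW₂ := fun x hx y hy => H.derivW₁ y hy x hx
    derivU₂ := fun x hx y hy => H.derivV₁ y hy x hx
    derivV₁ := fun x hx y hy => H.derivU₂ y hy x hx
    derivh₁ := fun x hx y hy => H.derivh₂ y hy x hx
    derivh₂ := fun x hx y hy => H.derivh₁ y hy x hx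
    h_nonneg := fun x hx y hy => H.h_nonneg y hy x hx
    h_time := fun x hx y hy => by rw [abs_sub_comm]; exact H.h_time y hy x hx }

/-- The energy identity on the triangle `n < ν < μ < m`, with the error absorbed. -/
lemma WaveData.triangle_energy {T K : ℝ} {W U V Z h h₁ h₂ : ℝ → ℝ → ℝ}
    (H : WaveData T K W U V Z h h₁ h₂) (hK : 0 ≤ K) {n m : ℝ} (hn : 0 < n) (hnm : n ≤ m)
    (hm : m < T) :
    (∫ y in n..m, (V m y ^ 2 + h m y * W m y ^ 2)) + (∫ x in n..m, (U x n ^ 2 + h x n * W x n ^ 2))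
      ≤ (∫ t in n..m, (U t t ^ 2 + V t t ^ 2 + 2 * (h t t * W t t ^ 2)))
        + 2 * (∫ x in n..m, ∫ y in n..x, (Z x y - h x y * W x y) ^ 2)
        + (1 + K) * (∫ x in n..m, ∫ y in n..x, (V x y ^ 2 + h x y * W x y ^ 2))
        + (1 + K) * (∫ y in n..m, ∫ x in y..m, (U x y ^ 2 + h x y * W x y ^ 2)) := by
  have hsub : Icc n m ⊆ Ioo 0 T := fun t ht => ⟨hn.trans_le ht.1, ht.2.trans_lt hm⟩
  have hsub2 : Icc n m ×ˢ Icc n m ⊆ Ioo 0 T ×ˢ Ioo 0 T := prod_mono hsub hsub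
  have cW := H.contW.mono hsub2
  have cU := H.contU.mono hsub2
  have cV := H.contV.mono hsub2
  have cZ := H.contZ.mono hsub2
  have ch := H.conth.mono hsub2
  have ch₁ := H.conth₁.mono hsub2
  have ch₂ := H.conth₂.mono hsub2
  set P : ℝ → ℝ → ℝ := fun x y => U x y ^ 2 + h x y * W x y ^ 2 with hP
  set Q : ℝ → ℝ → ℝ := fun x y => V x y ^ 2 + h x y * W x y ^ 2 with hQ
  set F : ℝ → ℝ → ℝ := fun x y => (Z x y - h x y * W x y) ^ 2 with hF
  set P₂ : ℝ → ℝ → ℝ := fun x y =>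
    2 * U x y * Z x y + (h₂ x y * W x y ^ 2 + h x y * (2 * W x y * V x y)) with hP₂
  set Q₁ : ℝ → ℝ → ℝ := fun x y =>
    2 * V x y * Z x y + (h₁ x y * W x y ^ 2 + h x y * (2 * W x y * U x y)) with hQ₁
  have cP : ContinuousOn (fun p : ℝ × ℝ => P p.1 p.2) (Icc n m ×ˢ Icc n m) := by
    simp only [hP]; fun_prop
  have cQ : ContinuousOn (fun p : ℝ × ℝ => Q p.1 p.2) (Icc n m ×ˢ Icc n m) := by
    simp only [hQ]; fun_prop
  have cF : ContinuousOn (fun p : ℝ × ℝ => F p.1 p.2) (Icc n m ×ˢ Icc n m) := by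
    simp only [hF]; fun_prop
  have cP₂ : ContinuousOn (fun p : ℝ × ℝ => P₂ p.1 p.2) (Icc n m ×ˢ Icc n m) := by
    simp only [hP₂]; fun_prop
  have cQ₁ : ContinuousOn (fun p : ℝ × ℝ => Q₁ p.1 p.2) (Icc n m ×ˢ Icc n m) := by
    simp only [hQ₁]; fun_prop
  have slice₂ : ∀ {g : ℝ → ℝ → ℝ},
      ContinuousOn (fun p : ℝ × ℝ => g p.1 p.2) (Icc n m ×ˢ Icc n m) →
      ∀ x ∈ Icc n m, ContinuousOn (fun y => g x y) (Icc n m) := fun hg x hx =>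
    hg.comp (f := fun y => (x, y)) (by fun_prop) fun y hy => ⟨hx, hy⟩
  have slice₁ : ∀ {g : ℝ → ℝ → ℝ},
      ContinuousOn (fun p : ℝ × ℝ => g p.1 p.2) (Icc n m ×ˢ Icc n m) →
      ∀ y ∈ Icc n m, ContinuousOn (fun x => g x y) (Icc n m) := fun hg y hy =>
    hg.comp (f := fun x => (x, y)) (by fun_prop) fun x hx => ⟨hx, hy⟩
  have diag : ∀ {g : ℝ → ℝ → ℝ},
      ContinuousOn (fun p : ℝ × ℝ => g p.1 p.2) (Icc n m ×ˢ Icc n m) →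
      ContinuousOn (fun t => g t t) (Icc n m) := fun hg =>
    hg.comp (f := fun t => (t, t)) (by fun_prop) fun t ht => ⟨ht, ht⟩
  have ii : ∀ {g : ℝ → ℝ} {a b : ℝ}, ContinuousOn g (Icc n m) → n ≤ a → a ≤ b → b ≤ m →
      IntervalIntegrable g volume a b := fun hg ha hab hb =>
    (hg.mono (Icc_subset_Icc ha hb)).intervalIntegrable_of_Icc hab
  have ftcP : ∀ x ∈ Icc n m, ∫ y in n..x, P₂ x y = P x x - P x n := by
    intro x hx
    refine intervalIntegral.integral_eq_sub_of_hasDerivAt (f := fun y => P x y) (fun y hy => ?_)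
      (ii (slice₂ cP₂ x hx) le_rfl hx.1 hx.2)
    rw [uIcc_of_le hx.1] at hy
    have hx' := hsub hx
    have hy' := hsub ⟨hy.1, hy.2.trans hx.2⟩
    have := ((H.derivU₂ x hx' y hy').pow 2).add
      ((H.derivh₂ x hx' y hy').mul ((H.derivW₂ x hx' y hy').pow 2))
    refine this.congr_deriv ?_
    simp [hP₂]
  have ftcQ : ∀ y ∈ Icc n m, ∫ x in y..m, Q₁ x y = Q m y - Q y y := by
    intro y hy
    refine intervalIntegral.integral_eq_sub_of_hasDerivAt (f := fun x => Q x y) (fun x hx => ?_)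
      (ii (slice₁ cQ₁ y hy) hy.1 hy.2 le_rfl)
    rw [uIcc_of_le hy.2] at hx
    have hy' := hsub hy
    have hx' := hsub ⟨hy.1.trans hx.1, hx.2⟩
    have := ((H.derivV₁ x hx' y hy').pow 2).add
      ((H.derivh₁ x hx' y hy').mul ((H.derivW₁ x hx' y hy').pow 2))
    refine this.congr_deriv ?_
    simp [hQ₁]
  have hnI : n ∈ Icc n m := left_mem_Icc.2 hnm
  have hmI : m ∈ Icc n m := right_mem_Icc.2 hnm
  obtain ⟨iP₂, -, -⟩ := triangle_fubini hnm cP₂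
  obtain ⟨iQ₁, -, eQ₁⟩ := triangle_fubini hnm cQ₁
  obtain ⟨iP, -, eP⟩ := triangle_fubini hnm cP
  obtain ⟨iQ, -, -⟩ := triangle_fubini hnm cQ
  obtain ⟨iF, -, -⟩ := triangle_fubini hnm cF
  have sP : ∫ x in n..m, ∫ y in n..x, P₂ x y = (∫ t in n..m, P t t) - ∫ x in n..m, P x n := by
    rw [← intervalIntegral.integral_sub (ii (diag cP) le_rfl hnm le_rfl)
      (ii (slice₁ cP n hnI) le_rfl hnm le_rfl)]
    refine intervalIntegral.integral_congr fun x hx => ?_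
    rw [uIcc_of_le hnm] at hx
    exact ftcP x hx
  have sQ : ∫ y in n..m, ∫ x in y..m, Q₁ x y = (∫ y in n..m, Q m y) - ∫ t in n..m, Q t t := by
    rw [← intervalIntegral.integral_sub (ii (slice₂ cQ m hmI) le_rfl hnm le_rfl)
      (ii (diag cQ) le_rfl hnm le_rfl)]
    refine intervalIntegral.integral_congr fun x hx => ?_
    rw [uIcc_of_le hnm] at hx
    exact ftcQ x hx
  have sD : (∫ t in n..m, (U t t ^ 2 + V t t ^ 2 + 2 * (h t t * W t t ^ 2)))
      = (∫ t in n..m, P t t) + ∫ t in n..m, Q t t := by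
    rw [← intervalIntegral.integral_add (ii (diag cP) le_rfl hnm le_rfl)
      (ii (diag cQ) le_rfl hnm le_rfl)]
    refine intervalIntegral.integral_congr fun x hx => ?_
    simp only [hP, hQ]; ring
  have point : ∀ x ∈ Ioo 0 T, ∀ y ∈ Ioo 0 T,
      Q₁ x y ≤ P₂ x y + 2 * F x y + (1 + K) * Q x y + (1 + K) * P x y := by
    intro x hx y hy
    have h0 := H.h_nonneg x hx y hy
    have h1 := (abs_le.1 (H.h_time x hx y hy)).2
    simp only [hP, hQ, hF, hP₂, hQ₁]
    have hW := mul_le_mul_of_nonneg_right h1 (sq_nonneg (W x y))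
    have hW0 := mul_nonneg h0 (sq_nonneg (W x y))
    nlinarith [sq_nonneg (U x y + (Z x y - h x y * W x y)),
      sq_nonneg (V x y - (Z x y - h x y * W x y)), mul_nonneg hK (sq_nonneg (U x y)),
      mul_nonneg hK (sq_nonneg (V x y)), mul_nonneg hK hW0]
  have ineq : ∫ x in n..m, ∫ y in n..x, Q₁ x y ≤ (∫ x in n..m, ∫ y in n..x, P₂ x y)
      + 2 * (∫ x in n..m, ∫ y in n..x, F x y) + (1 + K) * (∫ x in n..m, ∫ y in n..x, Q x y)
      + (1 + K) * (∫ x in n..m, ∫ y in n..x, P x y) := by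
    rw [← intervalIntegral.integral_const_mul, ← intervalIntegral.integral_const_mul,
      ← intervalIntegral.integral_const_mul, ← intervalIntegral.integral_add iP₂ (iF.const_mul _),
      ← intervalIntegral.integral_add (iP₂.add (iF.const_mul _)) (iQ.const_mul _),
      ← intervalIntegral.integral_add ((iP₂.add (iF.const_mul _)).add (iQ.const_mul _))
        (iP.const_mul _)]
    refine intervalIntegral.integral_mono_on hnm iQ₁
      (((iP₂.add (iF.const_mul _)).add (iQ.const_mul _)).add (iP.const_mul _)) fun x hx => ?_
    have jP₂ := ii (slice₂ cP₂ x hx) le_rfl hx.1 hx.2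
    have jF := (ii (slice₂ cF x hx) le_rfl hx.1 hx.2).const_mul 2
    have jQ := (ii (slice₂ cQ x hx) le_rfl hx.1 hx.2).const_mul (1 + K)
    have jP := (ii (slice₂ cP x hx) le_rfl hx.1 hx.2).const_mul (1 + K)
    rw [← intervalIntegral.integral_const_mul, ← intervalIntegral.integral_const_mul,
      ← intervalIntegral.integral_const_mul, ← intervalIntegral.integral_add jP₂ jF,
      ← intervalIntegral.integral_add (jP₂.add jF) jQ,
      ← intervalIntegral.integral_add ((jP₂.add jF).add jQ) jP]
    exact intervalIntegral.integral_mono_on hx.1 (ii (slice₂ cQ₁ x hx) le_rfl hx.1 hx.2)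
      (((jP₂.add jF).add jQ).add jP) fun y hy =>
        point x (hsub hx) y (hsub ⟨hy.1, hy.2.trans hx.2⟩)
  rw [eQ₁, sQ, sP, eP] at ineq
  rw [sD]
  linarith

lemma WaveData.triangle_bound {T K D₁ D₂ : ℝ} {W U V Z h h₁ h₂ : ℝ → ℝ → ℝ}
    (H : WaveData T K W U V Z h h₁ h₂) (hK : 0 ≤ K) (hT : 4 * (1 + K) * T ≤ 1)
    (hD₁ : ∀ n m, 0 < n → n ≤ m → m < T →
      ∫ t in n..m, (U t t ^ 2 + V t t ^ 2 + 2 * (h t t * W t t ^ 2)) ≤ D₁)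
    (hD₂ : ∀ n m, 0 < n → n ≤ m → m < T →
      ∫ x in n..m, ∫ y in n..x, (Z x y - h x y * W x y) ^ 2 ≤ D₂)
    {n m : ℝ} (hn : 0 < n) (hnm : n ≤ m) (hm : m < T) :
    (∫ y in n..m, (V m y ^ 2 + h m y * W m y ^ 2)) ≤ 2 * (D₁ + 2 * D₂) ∧
    (∫ x in n..m, (U x n ^ 2 + h x n * W x n ^ 2)) ≤ 2 * (D₁ + 2 * D₂) := by
  have hsub : Icc n m ⊆ Ioo 0 T := fun t ht => ⟨hn.trans_le ht.1, ht.2.trans_lt hm⟩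
  have hsub2 : Icc n m ×ˢ Icc n m ⊆ Ioo 0 T ×ˢ Ioo 0 T := prod_mono hsub hsub
  have cW := H.contW.mono hsub2
  have cU := H.contU.mono hsub2
  have cV := H.contV.mono hsub2
  have ch := H.conth.mono hsub2
  set P : ℝ → ℝ → ℝ := fun x y => U x y ^ 2 + h x y * W x y ^ 2 with hP
  set Q : ℝ → ℝ → ℝ := fun x y => V x y ^ 2 + h x y * W x y ^ 2 with hQ
  have cP : ContinuousOn (fun p : ℝ × ℝ => P p.1 p.2) (Icc n m ×ˢ Icc n m) := by
    simp only [hP]; fun_prop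
  have cQ : ContinuousOn (fun p : ℝ × ℝ => Q p.1 p.2) (Icc n m ×ˢ Icc n m) := by
    simp only [hQ]; fun_prop
  have P0 : ∀ x ∈ Icc n m, ∀ y ∈ Icc n m, 0 ≤ P x y := fun x hx y hy =>
    add_nonneg (sq_nonneg _) (mul_nonneg (H.h_nonneg x (hsub hx) y (hsub hy)) (sq_nonneg _))
  have Q0 : ∀ x ∈ Icc n m, ∀ y ∈ Icc n m, 0 ≤ Q x y := fun x hx y hy =>
    add_nonneg (sq_nonneg _) (mul_nonneg (H.h_nonneg x (hsub hx) y (hsub hy)) (sq_nonneg _))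
  have E0 : ∀ a b, n ≤ a → a ≤ b → b ≤ m → 0 ≤ ∫ y in a..b, Q b y := fun a b ha hab hb =>
    intervalIntegral.integral_nonneg hab fun y hy =>
      Q0 b ⟨ha.trans hab, hb⟩ y ⟨ha.trans hy.1, hy.2.trans hb⟩
  have F0 : ∀ a b, n ≤ a → a ≤ b → b ≤ m → 0 ≤ ∫ x in a..b, P x a := fun a b ha hab hb =>
    intervalIntegral.integral_nonneg hab fun x hx =>
      P0 x ⟨ha.trans hx.1, hx.2.trans hb⟩ a ⟨ha, hab.trans hb⟩
  set s : Set ℝ := {v | ∃ a b, n ≤ a ∧ a ≤ b ∧ b ≤ m ∧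
    v = (∫ y in a..b, Q b y) + ∫ x in a..b, P x a} with hs
  have hne : s.Nonempty := ⟨_, n, m, le_rfl, hnm, le_rfl, rfl⟩
  have hbdd : BddAbove s := by
    have hK2 : IsCompact (Icc n m ×ˢ Icc n m) := isCompact_Icc.prod isCompact_Icc
    obtain ⟨B₁, hB₁⟩ := hK2.exists_bound_of_continuousOn cP
    obtain ⟨B₂, hB₂⟩ := hK2.exists_bound_of_continuousOn cQ
    refine ⟨B₂ * |m - n| + B₁ * |m - n|, ?_⟩
    rintro v ⟨a, b, ha, hab, hb, rfl⟩
    have hB₁0 : 0 ≤ B₁ := (norm_nonneg _).trans (hB₁ (n, n) ⟨⟨le_rfl, hnm⟩, ⟨le_rfl, hnm⟩⟩)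
    have hB₂0 : 0 ≤ B₂ := (norm_nonneg _).trans (hB₂ (n, n) ⟨⟨le_rfl, hnm⟩, ⟨le_rfl, hnm⟩⟩)
    have hl : |b - a| ≤ |m - n| := by
      rw [abs_of_nonneg (by linarith), abs_of_nonneg (by linarith)]; linarith
    gcongr
    · refine ((Real.le_norm_self _).trans (intervalIntegral.norm_integral_le_of_norm_le_const
        (C := B₂) fun y hy => ?_)).trans (mul_le_mul_of_nonneg_left hl hB₂0)
      rw [uIoc_of_le hab] at hy
      exact hB₂ (b, y) ⟨⟨ha.trans hab, hb⟩, ⟨ha.trans hy.1.le, hy.2.trans hb⟩⟩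
    · refine ((Real.le_norm_self _).trans (intervalIntegral.norm_integral_le_of_norm_le_const
        (C := B₁) fun x hx => ?_)).trans (mul_le_mul_of_nonneg_left hl hB₁0)
      rw [uIoc_of_le hab] at hx
      exact hB₁ (x, a) ⟨⟨ha.trans hx.1.le, hx.2.trans hb⟩, ⟨ha, hab.trans hb⟩⟩
  have hle : ∀ a b, n ≤ a → a ≤ b → b ≤ m →
      (∫ y in a..b, Q b y) + (∫ x in a..b, P x a) ≤ sSup s := fun a b ha hab hb =>
    le_csSup hbdd ⟨a, b, ha, hab, hb, rfl⟩
  have hS0 : 0 ≤ sSup s :=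
    (add_nonneg (E0 n m le_rfl hnm le_rfl) (F0 n m le_rfl hnm le_rfl)).trans
      (hle n m le_rfl hnm le_rfl)
  have hS : sSup s ≤ D₁ + 2 * D₂ + sSup s / 2 := by
    refine csSup_le hne ?_
    rintro v ⟨a, b, ha, hab, hb, rfl⟩
    have ha0 : 0 < a := hn.trans_le ha
    have hbT : b < T := hb.trans_lt hm
    have hmono : Icc a b ×ˢ Icc a b ⊆ Icc n m ×ˢ Icc n m :=
      prod_mono (Icc_subset_Icc ha hb) (Icc_subset_Icc ha hb)
    obtain ⟨-, iP, -⟩ := triangle_fubini hab (cP.mono hmono)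
    obtain ⟨iQ, -, -⟩ := triangle_fubini hab (cQ.mono hmono)
    have bQ : ∫ x in a..b, ∫ y in a..x, Q x y ≤ T * sSup s := by
      calc _ ≤ ∫ _ in a..b, sSup s :=
            intervalIntegral.integral_mono_on hab iQ intervalIntegrable_const fun x hx => by
              have := hle a x ha hx.1 (hx.2.trans hb)
              have := F0 a x ha hx.1 (hx.2.trans hb)
              linarith
        _ = (b - a) * sSup s := by simp
        _ ≤ T * sSup s := by gcongr; linarith
    have bP : ∫ y in a..b, ∫ x in y..b, P x y ≤ T * sSup s := by
      calc _ ≤ ∫ _ in a..b, sSup s :=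
            intervalIntegral.integral_mono_on hab iP intervalIntegrable_const fun y hy => by
              have := hle y b (ha.trans hy.1) hy.2 hb
              have := E0 y b (ha.trans hy.1) hy.2 hb
              linarith
        _ = (b - a) * sSup s := by simp
        _ ≤ T * sSup s := by gcongr; linarith
    have main := H.triangle_energy hK ha0 hab hbT
    have d1 := hD₁ a b ha0 hab hbT
    have d2 := hD₂ a b ha0 hab hbT
    have e1 := mul_le_mul_of_nonneg_left bQ (by linarith : 0 ≤ 1 + K)
    have e2 := mul_le_mul_of_nonneg_left bP (by linarith : 0 ≤ 1 + K)
    have e3 := mul_le_mul_of_nonneg_right hT hS0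
    simp only [hP, hQ] at e1 e2 ⊢
    linarith
  have h1 := hle n m le_rfl hnm le_rfl
  have h2 := E0 n m le_rfl hnm le_rfl
  have h3 := F0 n m le_rfl hnm le_rfl
  exact ⟨by linarith, by linarith⟩

/-- The flux through the whole slice `μ = x`, from the triangles on both sides of the diagonal. -/
lemma WaveData.slice_bound {T K D₁ D₂ : ℝ} {W U V Z h h₁ h₂ : ℝ → ℝ → ℝ}
    (H : WaveData T K W U V Z h h₁ h₂) (hK : 0 ≤ K) (hT : 4 * (1 + K) * T ≤ 1)
    (hD₁ : ∀ n m, 0 < n → n ≤ m → m < T →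
      ∫ t in n..m, (U t t ^ 2 + V t t ^ 2 + 2 * (h t t * W t t ^ 2)) ≤ D₁)
    (hD₂ : ∀ n m, 0 < n → n ≤ m → m < T →
      ∫ x in n..m, ∫ y in n..x, (Z x y - h x y * W x y) ^ 2 ≤ D₂)
    (hD₂' : ∀ n m, 0 < n → n ≤ m → m < T →
      ∫ x in n..m, ∫ y in n..x, (Z y x - h y x * W y x) ^ 2 ≤ D₂)
    {n x m : ℝ} (hn : 0 < n) (hnx : n ≤ x) (hxm : x ≤ m) (hm : m < T) :
    (∫ y in n..m, (V x y ^ 2 + h x y * W x y ^ 2)) ≤ 4 * (D₁ + 2 * D₂) := by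
  have hxT : x ∈ Ioo 0 T := ⟨hn.trans_le hnx, hxm.trans_lt hm⟩
  have b1 := (H.triangle_bound hK hT hD₁ hD₂ hn hnx hxT.2).1
  have b2 := (H.swap.triangle_bound hK hT
    (fun n m h1 h2 h3 => by simpa only [add_comm (V _ _ ^ 2)] using hD₁ n m h1 h2 h3)
    hD₂' hxT.1 hxm hm).2
  have slice : ∀ {g : ℝ → ℝ → ℝ},
      ContinuousOn (fun p : ℝ × ℝ => g p.1 p.2) (Ioo 0 T ×ˢ Ioo 0 T) →
      ContinuousOn (fun y => g x y) (Ioo 0 T) := fun hg =>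
    hg.comp (f := fun y => (x, y)) (by fun_prop) fun y hy => ⟨hxT, hy⟩
  have cV := slice H.contV
  have cW := slice H.contW
  have ch := slice H.conth
  have c : ContinuousOn (fun y => V x y ^ 2 + h x y * W x y ^ 2) (Ioo 0 T) := by fun_prop
  rw [← intervalIntegral.integral_add_adjacent_intervals
    ((c.mono fun y hy => ⟨hn.trans_le hy.1, hy.2.trans_lt hxT.2⟩).intervalIntegrable_of_Icc hnx)
    ((c.mono fun y hy => ⟨hxT.1.trans_le hy.1, hy.2.trans_lt hm⟩).intervalIntegrable_of_Icc hxm)]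
  linarith

lemma lintegral_Ioo_le_of_integral_le {T R c : ℝ} (hc : c ∈ Ioo 0 T) {g : ℝ → ℝ}
    (cg : ContinuousOn g (Ioo 0 T)) (g0 : ∀ y ∈ Ioo 0 T, 0 ≤ g y)
    (hb : ∀ n m, 0 < n → n ≤ c → c ≤ m → m < T → ∫ y in n..m, g y ≤ R) :
    ∫⁻ y in Ioo 0 T, ENNReal.ofReal (g y) ≤ ENNReal.ofReal R := by
  have hcov : AECover (volume.restrict (Ioo 0 T)) ((nhdsWithin 0 (Ioi 0)) ×ˢ (nhdsWithin T (Iio T)))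
      (fun p : ℝ × ℝ => Icc p.1 p.2) :=
    aecover_Ioo_of_Icc (Filter.tendsto_fst.mono_right nhdsWithin_le_nhds)
      (Filter.tendsto_snd.mono_right nhdsWithin_le_nhds)
  refine le_of_tendsto (hcov.lintegral_tendsto_of_countably_generated
    (cg.aemeasurable measurableSet_Ioo).ennreal_ofReal) ?_
  filter_upwards [Filter.prod_mem_prod (Ioc_mem_nhdsGT hc.1) (Ico_mem_nhdsLT hc.2)]
    with p ⟨⟨h1, h2⟩, ⟨h3, h4⟩⟩
  have hsub : Icc p.1 p.2 ⊆ Ioo 0 T := fun t ht => ⟨h1.trans_le ht.1, ht.2.trans_lt h4⟩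
  rw [Measure.restrict_restrict measurableSet_Icc, inter_eq_left.2 hsub,
    ← ofReal_integral_eq_lintegral_ofReal
      ((cg.mono hsub).integrableOn_compact isCompact_Icc)
      (ae_restrict_of_forall_mem measurableSet_Icc fun y hy => g0 y (hsub hy))]
  refine ENNReal.ofReal_le_ofReal ?_
  rw [integral_Icc_eq_integral_Ioc, ← intervalIntegral.integral_of_le (h2.trans h3)]
  exact hb _ _ h1 h2 h3 h4

lemma ofReal_intervalIntegral_le_lintegral {n m : ℝ} (hnm : n ≤ m) {g : ℝ → ℝ}
    (ig : IntervalIntegrable g volume n m) (g0 : ∀ y ∈ Icc n m, 0 ≤ g y) {s : Set ℝ}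
    (hs : Icc n m ⊆ s) :
    ENNReal.ofReal (∫ y in n..m, g y) ≤ ∫⁻ y in s, ENNReal.ofReal (g y) := by
  rw [intervalIntegral.integral_of_le hnm, ofReal_integral_eq_lintegral_ofReal ig.1
    (ae_restrict_of_forall_mem measurableSet_Ioc fun y hy => g0 y (Ioc_subset_Icc_self hy))]
  exact lintegral_mono_set (Ioc_subset_Icc_self.trans hs)

lemma integral_triangle_le_toReal {T n m : ℝ} (hn : 0 < n) (hnm : n ≤ m) (hm : m < T)
    {g : ℝ → ℝ → ℝ} (cg : ContinuousOn (fun p : ℝ × ℝ => g p.1 p.2) (Ioo 0 T ×ˢ Ioo 0 T))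
    (g0 : ∀ x y, 0 ≤ g x y) {X : ℝ≥0∞} (hX : X ≠ ⊤)
    (hg : ∫⁻ x in Ioo 0 T, ∫⁻ y in Ioo 0 T, ENNReal.ofReal (g x y) ≤ X) :
    ∫ x in n..m, ∫ y in n..x, g x y ≤ X.toReal := by
  have hsub : Icc n m ⊆ Ioo 0 T := fun t ht => ⟨hn.trans_le ht.1, ht.2.trans_lt hm⟩
  rw [← ENNReal.ofReal_le_iff_le_toReal hX]
  obtain ⟨ig, -, -⟩ := triangle_fubini hnm (cg.mono (prod_mono hsub hsub))
  calc ENNReal.ofReal (∫ x in n..m, ∫ y in n..x, g x y)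
      ≤ ∫⁻ x in Icc n m, ENNReal.ofReal (∫ y in n..x, g x y) :=
        ofReal_intervalIntegral_le_lintegral hnm ig
          (fun x hx => intervalIntegral.integral_nonneg hx.1 fun y _ => g0 x y) Subset.rfl
    _ ≤ ∫⁻ x in Icc n m, ∫⁻ y in Ioo 0 T, ENNReal.ofReal (g x y) := by
        refine setLIntegral_mono' measurableSet_Icc fun x hx => ?_
        have hsubx : Icc n x ⊆ Ioo 0 T := (Icc_subset_Icc_right hx.2).trans hsub
        refine ofReal_intervalIntegral_le_lintegral hx.1 ?_ (fun y _ => g0 x y) hsubx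
        exact (cg.comp (f := fun y => (x, y)) (by fun_prop)
          fun y hy => ⟨hsub hx, hsubx hy⟩).intervalIntegrable_of_Icc hx.1
    _ ≤ ∫⁻ x in Ioo 0 T, ∫⁻ y in Ioo 0 T, ENNReal.ofReal (g x y) := lintegral_mono_set hsub
    _ ≤ X := hg

lemma harmonicMean_mem_Ioo {T x y : ℝ} (hx : x ∈ Ioo 0 T) (hy : y ∈ Ioo 0 T) :
    2 * x * y / (x + y) ∈ Ioo 0 T := by
  obtain ⟨hx0, hxT⟩ := hx
  obtain ⟨hy0, hyT⟩ := hy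
  refine ⟨by positivity, ?_⟩
  rw [div_lt_iff₀ (by positivity)]
  nlinarith

lemma hasDerivAt_potential {A : ℝ → ℝ} {a' x y : ℝ} (hs : x + y ≠ 0)
    (hA : HasDerivAt A a' (2 * x * y / (x + y))) :
    HasDerivAt (fun b => A (2 * x * b / (x + b)) / (x + b) ^ 2)
      (a' * (2 * x ^ 2) / (x + y) ^ 4 - 2 * A (2 * x * y / (x + y)) / (x + y) ^ 3) y := by
  have h1 : HasDerivAt (fun b => x + b) 1 y := (hasDerivAt_id y).const_add x
  have h2 : HasDerivAt (fun b => 2 * x * b) (2 * x) y := by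
    simpa using (hasDerivAt_id y).const_mul (2 * x)
  have h3 := (HasDerivAt.comp y hA (h2.div h1 hs)).div (h1.pow 2) (pow_ne_zero 2 hs)
  refine h3.congr_deriv ?_
  simp only [Function.comp_apply, Pi.div_apply, Pi.pow_apply]
  field_simp
  ring

lemma waveData_of_contDiffOn {T M c₀ : ℝ} {A A' : ℝ → ℝ} (hc₀ : 0 < c₀) (hM : 0 ≤ M)
    (hA : ∀ x ∈ Ioo 0 T, HasDerivAt A (A' x) x) (cA' : ContinuousOn A' (Ioo 0 T))
    (hcA : ∀ x ∈ Ioo 0 T, c₀ ≤ A x) (hA' : ∀ x ∈ Ioo 0 T, |A' x| ≤ M) {W : ℝ → ℝ → ℝ}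
    (hW : ContDiffOn ℝ (⊤ : ℕ∞) (fun p : ℝ × ℝ => W p.1 p.2) (Ioo 0 T ×ˢ Ioo 0 T)) :
    (∃ h₁ h₂, WaveData T (2 * M / c₀) W (fun x y => deriv (fun a => W a y) x)
      (fun x y => deriv (W x) y) (fun x y => deriv (fun a => deriv (fun b => W a b) y) x)
      (fun x y => A (2 * x * y / (x + y)) / (x + y) ^ 2) h₁ h₂) ∧
    ∀ t ∈ Ioo 0 T, HasDerivAt (fun t => W t t) (deriv (fun a => W a t) t + deriv (W t) t) t := by
  set S : Set (ℝ × ℝ) := Ioo 0 T ×ˢ Ioo 0 T with hS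
  have oS : IsOpen S := isOpen_Ioo.prod isOpen_Ioo
  set F : ℝ × ℝ → ℝ := fun p => W p.1 p.2 with hF
  have dF : ∀ p ∈ S, HasFDerivAt F (fderiv ℝ F p) p := fun p hp =>
    ((hW.contDiffAt (oS.mem_nhds hp)).differentiableAt (by simp)).hasFDerivAt
  have hF' : ContDiffOn ℝ 1 (fderiv ℝ F) S := hW.fderiv_of_isOpen oS (by norm_cast)
  have dF' : ∀ p ∈ S, HasFDerivAt (fderiv ℝ F) (fderiv ℝ (fderiv ℝ F) p) p := fun p hp =>
    ((hF'.contDiffAt (oS.mem_nhds hp)).differentiableAt (by simp)).hasFDerivAt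
  have cF'' : ContinuousOn (fderiv ℝ (fderiv ℝ F)) S :=
    hF'.continuousOn_fderiv_of_isOpen oS le_rfl
  have line₁ : ∀ x y : ℝ, HasDerivAt (fun a : ℝ => (a, y)) ((1 : ℝ), (0 : ℝ)) x := fun x y =>
    (hasDerivAt_id x).prodMk (hasDerivAt_const x y)
  have line₂ : ∀ x y : ℝ, HasDerivAt (fun b : ℝ => (x, b)) ((0 : ℝ), (1 : ℝ)) y := fun x y =>
    (hasDerivAt_const y x).prodMk (hasDerivAt_id y)
  have hW₁ : ∀ x ∈ Ioo 0 T, ∀ y ∈ Ioo 0 T,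
      HasDerivAt (fun a => W a y) (fderiv ℝ F (x, y) (1, 0)) x := fun x hx y hy =>
    (dF (x, y) ⟨hx, hy⟩).comp_hasDerivAt (f := fun a => (a, y)) x (line₁ x y)
  have hW₂ : ∀ x ∈ Ioo 0 T, ∀ y ∈ Ioo 0 T,
      HasDerivAt (W x) (fderiv ℝ F (x, y) (0, 1)) y := fun x hx y hy =>
    (dF (x, y) ⟨hx, hy⟩).comp_hasDerivAt (f := fun b => (x, b)) y (line₂ x y)
  have hU₂ : ∀ x ∈ Ioo 0 T, ∀ y ∈ Ioo 0 T, HasDerivAt (fun b => deriv (fun a => W a b) x)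
      (fderiv ℝ (fderiv ℝ F) (x, y) (0, 1) (1, 0)) y := by
    intro x hx y hy
    have h1 := ((dF' (x, y) ⟨hx, hy⟩).comp_hasDerivAt (f := fun b => (x, b)) y
      (line₂ x y)).clm_apply (hasDerivAt_const y ((1 : ℝ), (0 : ℝ)))
    simp only [map_zero, add_zero] at h1
    refine h1.congr_of_eventuallyEq ?_
    filter_upwards [isOpen_Ioo.mem_nhds hy] with b hb
    exact (hW₁ x hx b hb).deriv
  have hV₁ : ∀ x ∈ Ioo 0 T, ∀ y ∈ Ioo 0 T, HasDerivAt (fun a => deriv (W a) y)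
      (fderiv ℝ (fderiv ℝ F) (x, y) (1, 0) (0, 1)) x := by
    intro x hx y hy
    have h1 := ((dF' (x, y) ⟨hx, hy⟩).comp_hasDerivAt (f := fun a => (a, y)) x
      (line₁ x y)).clm_apply (hasDerivAt_const x ((0 : ℝ), (1 : ℝ)))
    simp only [map_zero, add_zero] at h1
    refine h1.congr_of_eventuallyEq ?_
    filter_upwards [isOpen_Ioo.mem_nhds hx] with a ha
    exact (hW₂ a ha y hy).deriv
  have symm : ∀ p ∈ S, fderiv ℝ (fderiv ℝ F) p (0, 1) (1, 0)
      = fderiv ℝ (fderiv ℝ F) p (1, 0) (0, 1) := fun p hp =>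
    (hW.contDiffAt (oS.mem_nhds hp)).isSymmSndFDerivAt
      (by simpa using WithTop.coe_le_coe.2 (le_top : (2 : ℕ∞) ≤ ⊤)) _ _
  have cA : ContinuousOn A (Ioo 0 T) := fun x hx => (hA x hx).continuousAt.continuousWithinAt
  have pos : ∀ p ∈ S, p.1 + p.2 ≠ 0 := fun p hp => (add_pos hp.1.1 hp.2.1).ne'
  have cξ : ContinuousOn (fun p : ℝ × ℝ => 2 * p.1 * p.2 / (p.1 + p.2)) S :=
    ContinuousOn.div (by fun_prop) (by fun_prop) pos
  have cAξ : ContinuousOn (fun p : ℝ × ℝ => A (2 * p.1 * p.2 / (p.1 + p.2))) S :=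
    cA.comp cξ fun p hp => harmonicMean_mem_Ioo hp.1 hp.2
  have cA'ξ : ContinuousOn (fun p : ℝ × ℝ => A' (2 * p.1 * p.2 / (p.1 + p.2))) S :=
    cA'.comp cξ fun p hp => harmonicMean_mem_Ioo hp.1 hp.2
  have cderiv : ∀ r : ℝ × ℝ → ℝ, Continuous r → ContinuousOn (fun p : ℝ × ℝ =>
      A' (2 * p.1 * p.2 / (p.1 + p.2)) * (2 * r p ^ 2) / (p.1 + p.2) ^ 4
        - 2 * A (2 * p.1 * p.2 / (p.1 + p.2)) / (p.1 + p.2) ^ 3) S := fun r hr =>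
    ((cA'ξ.mul (by fun_prop)).div (by fun_prop) fun p hp => pow_ne_zero 4 (pos p hp)).sub
      ((continuousOn_const.mul cAξ).div (by fun_prop) fun p hp => pow_ne_zero 3 (pos p hp))
  refine ⟨⟨fun x y => A' (2 * x * y / (x + y)) * (2 * y ^ 2) / (x + y) ^ 4
        - 2 * A (2 * x * y / (x + y)) / (x + y) ^ 3,
      fun x y => A' (2 * x * y / (x + y)) * (2 * x ^ 2) / (x + y) ^ 4
        - 2 * A (2 * x * y / (x + y)) / (x + y) ^ 3, ?_⟩, ?_⟩
  · exact
    { contW := hW.continuousOn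
      contU := (hF'.continuousOn.clm_apply continuousOn_const).congr fun p hp =>
        (hW₁ p.1 hp.1 p.2 hp.2).deriv
      contV := (hF'.continuousOn.clm_apply continuousOn_const).congr fun p hp =>
        (hW₂ p.1 hp.1 p.2 hp.2).deriv
      contZ := ((cF''.clm_apply continuousOn_const).clm_apply continuousOn_const).congr
        fun p hp => (hV₁ p.1 hp.1 p.2 hp.2).deriv
      conth := cAξ.div (by fun_prop) fun p hp => pow_ne_zero 2 (pos p hp)
      conth₁ := cderiv Prod.snd continuous_snd
      conth₂ := cderiv Prod.fst continuous_fst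
      derivW₁ := fun x hx y hy => (hW₁ x hx y hy).differentiableAt.hasDerivAt
      derivW₂ := fun x hx y hy => (hW₂ x hx y hy).differentiableAt.hasDerivAt
      derivU₂ := fun x hx y hy =>
        (hU₂ x hx y hy).congr_deriv ((symm (x, y) ⟨hx, hy⟩).trans (hV₁ x hx y hy).deriv.symm)
      derivV₁ := fun x hx y hy => (hV₁ x hx y hy).differentiableAt.hasDerivAt
      derivh₁ := fun x hx y hy => by
        have e : ∀ a, 2 * y * a = 2 * a * y := fun a => by ring
        have := hasDerivAt_potential (A := A) (a' := A' (2 * x * y / (x + y))) (x := y) (y := x)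
          (by rw [add_comm]; exact pos (x, y) ⟨hx, hy⟩)
          (by rw [e, add_comm y x]; exact hA _ (harmonicMean_mem_Ioo hx hy))
        simpa only [e, add_comm y] using this
      derivh₂ := fun x hx y hy => hasDerivAt_potential (pos (x, y) ⟨hx, hy⟩)
        (hA _ (harmonicMean_mem_Ioo hx hy))
      h_nonneg := fun x hx y hy =>
        div_nonneg (hc₀.le.trans (hcA _ (harmonicMean_mem_Ioo hx hy))) (sq_nonneg _)
      h_time := fun x hx y hy => by
        have hx0 := hx.1
        have hy0 := hy.1
        have hs : 0 < x + y := add_pos hx0 hy0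
        have hξ := harmonicMean_mem_Ioo hx hy
        set α := A (2 * x * y / (x + y))
        set α' := A' (2 * x * y / (x + y))
        have e : α' * (2 * y ^ 2) / (x + y) ^ 4 - 2 * α / (x + y) ^ 3
            - (α' * (2 * x ^ 2) / (x + y) ^ 4 - 2 * α / (x + y) ^ 3)
            = 2 * α' * ((y - x) / (x + y)) / (x + y) ^ 2 := by
          field_simp
          ring
        have h1 : |(y - x) / (x + y)| ≤ 1 := by
          rw [abs_div, abs_of_pos hs, div_le_one hs, abs_le]
          constructor <;> linarith
        have h2 : M ≤ M / c₀ * α := by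
          rw [div_mul_eq_mul_div, le_div_iff₀ hc₀]
          exact mul_le_mul_of_nonneg_left (hcA _ hξ) hM
        rw [e, abs_div, abs_mul, abs_mul, abs_of_pos (by positivity : 0 < (x + y) ^ 2),
          ← mul_div_assoc]
        refine div_le_div_of_nonneg_right ?_ (sq_nonneg _)
        calc |(2 : ℝ)| * |α'| * |(y - x) / (x + y)| ≤ 2 * M * 1 := by
              rw [abs_of_pos two_pos]
              gcongr
              exact hA' _ hξ
          _ ≤ 2 * M / c₀ * α := by rw [mul_div_assoc, mul_assoc]; linarith }
  · intro t ht
    have h1 := (dF (t, t) ⟨ht, ht⟩).comp_hasDerivAt (f := fun a => (a, a)) t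
      ((hasDerivAt_id t).prodMk (hasDerivAt_id t))
    refine h1.congr_deriv ?_
    rw [(hW₁ t ht t ht).deriv, (hW₂ t ht t ht).deriv, ← map_add]
    simp

lemma sobNormSq_one (T j : ℝ) (q : ℝ → ℝ) : sobNormSq T 1 j q
    = (∫⁻ t in Ioo 0 T, ENNReal.ofReal ((t ^ (-j) * q t) ^ 2))
      + ∫⁻ t in Ioo 0 T, ENNReal.ofReal (deriv (fun t => t ^ (-j) * q t) t ^ 2) := by
  simp [sobNormSq, Finset.sum_range_succ, iteratedDeriv_one]

/-- The diagonal energy density is controlled by the weighted Sobolev norms of the traces. -/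
lemma lintegral_diag_le {T M : ℝ} (hT : T ≤ 1) (hM : 0 ≤ M) {q₁ q₁' q₂ h : ℝ → ℝ}
    (hq₁ : ∀ t ∈ Ioo 0 T, HasDerivAt q₁ (q₁' t) t)
    (hh : ∀ t ∈ Ioo 0 T, h t ≤ M / (t + t) ^ 2) :
    ∫⁻ t in Ioo 0 T, ENNReal.ofReal (q₂ t ^ 2 + (q₁' t - q₂ t) ^ 2 + 2 * (h t * q₁ t ^ 2))
      ≤ ENNReal.ofReal (7 + M) * (sobNormSq T 1 1 q₁ + sobNormSq T 1 1 q₂) := by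
  set u : ℝ → ℝ := fun t => t ^ (-1 : ℝ) * q₁ t with hu
  set w : ℝ → ℝ := fun t => t ^ (-1 : ℝ) * q₂ t with hw
  have hu' : ∀ t ∈ Ioo 0 T, HasDerivAt u (-1 * t ^ (-1 - 1 : ℝ) * q₁ t + t ^ (-1 : ℝ) * q₁' t) t :=
    fun t ht => (Real.hasDerivAt_rpow_const (Or.inl ht.1.ne')).mul (hq₁ t ht)
  have mu : AEMeasurable (fun t => ENNReal.ofReal (u t ^ 2)) (volume.restrict (Ioo 0 T)) := by
    have cu : ContinuousOn u (Ioo 0 T) := fun t ht => (hu' t ht).continuousAt.continuousWithinAt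
    exact ((cu.pow 2).aemeasurable measurableSet_Ioo).ennreal_ofReal
  have point : ∀ t ∈ Ioo 0 T, q₂ t ^ 2 + (q₁' t - q₂ t) ^ 2 + 2 * (h t * q₁ t ^ 2)
      ≤ (7 + M) * (u t ^ 2 + (deriv u t ^ 2 + w t ^ 2)) := by
    intro t ht
    have t0 := ht.1
    have t1 : t ≤ 1 := ht.2.le.trans hT
    have e1 : q₁ t = t * u t := by
      simp only [hu, Real.rpow_neg_one]; field_simp
    have e2 : q₂ t = t * w t := by
      simp only [hw, Real.rpow_neg_one]; field_simp
    have e3 : q₁' t = u t + t * deriv u t := by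
      rw [(hu' t ht).deriv, Real.rpow_sub_one t0.ne']
      simp only [hu, Real.rpow_neg_one]; field_simp; ring
    have hq := mul_le_mul_of_nonneg_right (hh t ht) (sq_nonneg (q₁ t))
    have e4 : M / (t + t) ^ 2 * q₁ t ^ 2 = M / 4 * u t ^ 2 := by
      rw [e1]; field_simp; ring
    rw [e4] at hq
    rw [e3, e2]
    generalize u t = a at *
    generalize w t = c at *
    generalize deriv u t = b at *
    have tt : t ^ 2 ≤ 1 := by nlinarith
    have b1 := mul_le_mul_of_nonneg_right tt (sq_nonneg b)
    have b2 := mul_le_mul_of_nonneg_right tt (sq_nonneg c)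
    nlinarith [sq_nonneg (a - t * b), sq_nonneg (a + t * c), sq_nonneg (t * b + t * c),
      mul_nonneg hM (sq_nonneg a), mul_nonneg hM (sq_nonneg b), mul_nonneg hM (sq_nonneg c),
      sq_nonneg a, sq_nonneg b, sq_nonneg c]
  calc _ ≤ ∫⁻ t in Ioo 0 T, ENNReal.ofReal (7 + M) * (ENNReal.ofReal (u t ^ 2)
            + (ENNReal.ofReal (deriv u t ^ 2) + ENNReal.ofReal (w t ^ 2))) := by
        refine setLIntegral_mono' measurableSet_Ioo fun t ht => ?_
        rw [← ENNReal.ofReal_add (sq_nonneg _) (sq_nonneg _),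
          ← ENNReal.ofReal_add (sq_nonneg _) (by positivity),
          ← ENNReal.ofReal_mul (by positivity)]
        exact ENNReal.ofReal_le_ofReal (point t ht)
    _ = ENNReal.ofReal (7 + M) * ((∫⁻ t in Ioo 0 T, ENNReal.ofReal (u t ^ 2))
          + ((∫⁻ t in Ioo 0 T, ENNReal.ofReal (deriv u t ^ 2))
            + ∫⁻ t in Ioo 0 T, ENNReal.ofReal (w t ^ 2))) := by
        rw [lintegral_const_mul' _ _ ENNReal.ofReal_ne_top, lintegral_add_left' mu,
          lintegral_add_left ((measurable_deriv u).pow_const 2).ennreal_ofReal]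
    _ ≤ _ := by
        rw [sobNormSq_one, sobNormSq_one, ← add_assoc]
        gcongr
        exact le_self_add

lemma lintegral_slice_le {T c l R : ℝ} (hc : 0 < c) (hl : 0 ≤ l) {x : ℝ} (hx : x ∈ Ioo 0 T)
    {v w h : ℝ → ℝ} (cv : ContinuousOn v (Ioo 0 T)) (cw : ContinuousOn w (Ioo 0 T))
    (ch : ContinuousOn h (Ioo 0 T)) (hh : ∀ y ∈ Ioo 0 T, c / (x + y) ^ 2 ≤ h y)
    (hb : ∀ n m, 0 < n → n ≤ x → x ≤ m → m < T → ∫ y in n..m, (v y ^ 2 + h y * w y ^ 2) ≤ R) :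
    ∫⁻ y in Ioo 0 T, ENNReal.ofReal (v y ^ 2 + (x + y) ^ (-2 : ℝ) * l * w y ^ 2)
      ≤ ENNReal.ofReal ((1 + l / c) * R) := by
  have h0 : ∀ y ∈ Ioo 0 T, 0 ≤ h y := fun y hy =>
    (div_nonneg hc.le (sq_nonneg _)).trans (hh y hy)
  have hlc : 0 ≤ l / c := by positivity
  have main := lintegral_Ioo_le_of_integral_le hx (g := fun y => v y ^ 2 + h y * w y ^ 2)
    (by fun_prop) (fun y hy => add_nonneg (sq_nonneg _) (mul_nonneg (h0 y hy) (sq_nonneg _))) hb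
  rw [ENNReal.ofReal_mul (by positivity)]
  refine le_trans ?_ (mul_le_mul_right main _)
  rw [← lintegral_const_mul' _ _ ENNReal.ofReal_ne_top]
  refine setLIntegral_mono' measurableSet_Ioo fun y hy => ?_
  rw [← ENNReal.ofReal_mul (by positivity)]
  refine ENNReal.ofReal_le_ofReal ?_
  have hs : 0 < x + y := add_pos hx.1 hy.1
  have e : (x + y) ^ (-2 : ℝ) = ((x + y) ^ 2)⁻¹ := by
    rw [Real.rpow_neg hs.le]; norm_cast
  have k : ((x + y) ^ 2)⁻¹ * l ≤ l / c * h y := by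
    calc ((x + y) ^ 2)⁻¹ * l = l / c * (c / (x + y) ^ 2) := by field_simp
      _ ≤ _ := mul_le_mul_of_nonneg_left (hh y hy) hlc
  rw [e]
  have k2 := mul_le_mul_of_nonneg_right k (sq_nonneg (w y))
  nlinarith [mul_nonneg hlc (sq_nonneg (v y)), mul_nonneg (h0 y hy) (sq_nonneg (w y))]

lemma exists_deriv_bound {ε T : ℝ} {A : ℝ → ℝ} (hA : ContDiffOn ℝ (⊤ : ℕ∞) A (Ico 0 ε))
    (hT : T < ε) : ∃ M, 0 ≤ M ∧ ∀ x ∈ Ioo 0 T, |A x| ≤ M ∧ |deriv A x| ≤ M := by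
  have hsub : Icc 0 T ⊆ Ico 0 ε := fun x hx => ⟨hx.1, hx.2.trans_lt hT⟩
  obtain ⟨M₁, h₁⟩ := isCompact_Icc.exists_bound_of_continuousOn (hA.continuousOn.mono hsub)
  obtain ⟨M₂, h₂⟩ := isCompact_Icc.exists_bound_of_continuousOn
    ((hA.continuousOn_derivWithin (uniqueDiffOn_Ico 0 ε) (by simp)).mono hsub)
  refine ⟨max 0 (max M₁ M₂), le_max_left _ _, fun x hx => ⟨?_, ?_⟩⟩
  · exact (h₁ x (Ioo_subset_Icc_self hx)).trans ((le_max_left _ _).trans (le_max_right _ _))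
  · rw [← derivWithin_of_mem_nhds (Ico_mem_nhds hx.1 (hx.2.trans hT))]
    exact (h₂ x (Ioo_subset_Icc_self hx)).trans ((le_max_right _ _).trans (le_max_right _ _))

/-- scalar (eigenfunction-mode) slice energy estimate for
`(μ+ν)² ∂_μ∂_ν W − (λ φ(2μν/(μ+ν)) + B(2μν/(μ+ν))) W = G`. -/
theorem stmt7 (ε : ℝ) (hε : 0 < ε) (φ B : ℝ → ℝ)
    (hφ : ContDiffOn ℝ (⊤ : ℕ∞) φ (Ico 0 ε)) (hB : ContDiffOn ℝ (⊤ : ℕ∞) B (Ico 0 ε))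
    (lam c₀ : ℝ) (hlam : 0 ≤ lam) (hc₀ : 0 < c₀)
    (hφpos : ∀ x ∈ Ico (0 : ℝ) ε, 0 < φ x)
    (hcoer : ∀ x ∈ Ico (0 : ℝ) ε, c₀ ≤ lam * φ x + B x) :
    ∃ T₀ C : ℝ, 0 < T₀ ∧ T₀ ≤ ε / 2 ∧ 0 < C ∧
      ∀ T : ℝ, 0 < T → T ≤ T₀ →
      ∀ G : ℝ → ℝ → ℝ, Measurable (fun p : ℝ × ℝ => G p.1 p.2) →
        srcNormSq T 2 G ≠ ⊤ →
      ∀ W : ℝ → ℝ → ℝ,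
        ContDiffOn ℝ (⊤ : ℕ∞) (fun p : ℝ × ℝ => W p.1 p.2) (Ioo 0 T ×ˢ Ioo 0 T) →
        (∀ μ ∈ Ioo (0 : ℝ) T, ∀ ν ∈ Ioo (0 : ℝ) T,
          (μ + ν) ^ 2 * deriv (fun a => deriv (fun b => W a b) ν) μ
            - (lam * φ (2 * μ * ν / (μ + ν)) + B (2 * μ * ν / (μ + ν))) * W μ ν = G μ ν) →
        sobNormSq T 1 1 (fun t => W t t) ≠ ⊤ →
        sobNormSq T 1 1 (fun t => deriv (fun a => W a t) t) ≠ ⊤ →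
        (∀ μ ∈ Ioo (0 : ℝ) T,
          (∫⁻ ν in Ioo (0 : ℝ) T, ENNReal.ofReal ((deriv (W μ) ν) ^ 2
              + (μ + ν) ^ (-2 : ℝ) * (lam + 1) * (W μ ν) ^ 2))
            ≤ ENNReal.ofReal C *
              (sobNormSq T 1 1 (fun t => W t t)
                + sobNormSq T 1 1 (fun t => deriv (fun a => W a t) t)
                + srcNormSq T 2 G)) ∧
        (∀ ν ∈ Ioo (0 : ℝ) T,
          (∫⁻ μ in Ioo (0 : ℝ) T, ENNReal.ofReal ((deriv (fun a => W a ν) μ) ^ 2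
              + (μ + ν) ^ (-2 : ℝ) * (lam + 1) * (W μ ν) ^ 2))
            ≤ ENNReal.ofReal C *
              (sobNormSq T 1 1 (fun t => W t t)
                + sobNormSq T 1 1 (fun t => deriv (fun a => W a t) t)
                + srcNormSq T 2 G)) := by
  set A : ℝ → ℝ := fun x => lam * φ x + B x with hAdef
  have sA : ContDiffOn ℝ (⊤ : ℕ∞) A (Ico 0 ε) := (contDiffOn_const.mul hφ).add hB
  obtain ⟨M, hM, hAM⟩ := exists_deriv_bound sA (half_lt_self hε)
  set K : ℝ := 2 * M / c₀ with hKdef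
  have hK : 0 ≤ K := by positivity
  refine ⟨min (min (ε / 2) 1) (1 / (4 * (1 + K))),
    (1 + (lam + 1) / c₀) * (4 * ((7 + M) + 2)), by positivity,
    (min_le_left _ _).trans (min_le_left _ _), by positivity, ?_⟩
  intro T hT0 hT G mG hG W hW hPDE hq₁ hq₂
  have hTε : T ≤ ε / 2 := hT.trans ((min_le_left _ _).trans (min_le_left _ _))
  have hT1 : T ≤ 1 := hT.trans ((min_le_left _ _).trans (min_le_right _ _))
  have hTK : 4 * (1 + K) * T ≤ 1 := by
    have := hT.trans (min_le_right _ _)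
    rwa [le_div_iff₀ (by positivity), mul_comm] at this
  have hIoo : Ioo 0 T ⊆ Ioo 0 (ε / 2) := Ioo_subset_Ioo_right hTε
  have hIoo' : Ioo 0 T ⊆ Ioo 0 ε := Ioo_subset_Ioo_right (by linarith)
  have sA' : ContDiffOn ℝ (⊤ : ℕ∞) A (Ioo 0 T) := sA.mono (hIoo'.trans Ioo_subset_Ico_self)
  obtain ⟨⟨h₁, h₂, H⟩, hdiag⟩ := waveData_of_contDiffOn (A := A) (A' := deriv A) hc₀ hM
    (fun x hx => ((sA'.contDiffAt (isOpen_Ioo.mem_nhds hx)).differentiableAt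
      (by simp)).hasDerivAt)
    (sA'.continuousOn_deriv_of_isOpen isOpen_Ioo (by simp))
    (fun x hx => hcoer x (Ioo_subset_Ico_self (hIoo' hx)))
    (fun x hx => (hAM x (hIoo hx)).2) hW
  set q₁ : ℝ → ℝ := fun t => W t t
  set q₂ : ℝ → ℝ := fun t => deriv (fun a => W a t) t
  set N := sobNormSq T 1 1 q₁ + sobNormSq T 1 1 q₂ + srcNormSq T 2 G with hN
  have hNtop : N ≠ ⊤ := ENNReal.add_ne_top.2 ⟨ENNReal.add_ne_top.2 ⟨hq₁, hq₂⟩, hG⟩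
  set f : ℝ → ℝ → ℝ := fun x y =>
    (deriv (fun a => deriv (fun b => W a b) y) x
      - A (2 * x * y / (x + y)) / (x + y) ^ 2 * W x y) ^ 2 with hf
  have cf : ContinuousOn (fun p : ℝ × ℝ => f p.1 p.2) (Ioo 0 T ×ˢ Ioo 0 T) :=
    (H.contZ.sub (H.conth.mul H.contW)).pow 2
  have fG : ∀ x ∈ Ioo 0 T, ∀ y ∈ Ioo 0 T, f x y = (x + y) ^ (-(2 * 2) : ℝ) * G x y ^ 2 := by
    intro x hx y hy
    have hs : 0 < x + y := add_pos hx.1 hy.1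
    have e : (x + y) ^ (-(2 * 2) : ℝ) = ((x + y) ^ 4)⁻¹ := by
      rw [Real.rpow_neg hs.le]; norm_num
    rw [e, ← hPDE x hx y hy]
    simp only [hf, hAdef]
    field_simp
  have mf : Measurable fun p : ℝ × ℝ =>
      ENNReal.ofReal ((p.1 + p.2) ^ (-(2 * 2) : ℝ) * G p.1 p.2 ^ 2) := by fun_prop
  have hsrc : srcNormSq T 2 G = ∫⁻ p, ENNReal.ofReal ((p.1 + p.2) ^ (-(2 * 2) : ℝ) * G p.1 p.2 ^ 2)
      ∂((volume.restrict (Ioo 0 T)).prod (volume.restrict (Ioo 0 T))) := by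
    rw [Measure.prod_restrict]; rfl
  have If : ∫⁻ x in Ioo 0 T, ∫⁻ y in Ioo 0 T, ENNReal.ofReal (f x y) ≤ N := by
    refine le_trans (le_of_eq ?_) (le_add_self : srcNormSq T 2 G ≤ N)
    rw [hsrc, lintegral_prod _ mf.aemeasurable]
    exact setLIntegral_congr_fun measurableSet_Ioo fun x hx =>
      setLIntegral_congr_fun measurableSet_Ioo fun y hy => by rw [fG x hx y hy]
  have If' : ∫⁻ x in Ioo 0 T, ∫⁻ y in Ioo 0 T, ENNReal.ofReal (f y x) ≤ N := by
    refine le_trans (le_of_eq ?_) (le_add_self : srcNormSq T 2 G ≤ N)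
    rw [hsrc, lintegral_prod_symm _ mf.aemeasurable]
    exact setLIntegral_congr_fun measurableSet_Ioo fun x hx =>
      setLIntegral_congr_fun measurableSet_Ioo fun y hy => by rw [fG y hy x hx]
  have hD₂ : ∀ n m, 0 < n → n ≤ m → m < T → ∫ x in n..m, ∫ y in n..x, f x y ≤ N.toReal :=
    fun n m hn hnm hm => integral_triangle_le_toReal hn hnm hm cf
      (fun x y => sq_nonneg _) hNtop If
  have hD₂' : ∀ n m, 0 < n → n ≤ m → m < T → ∫ x in n..m, ∫ y in n..x, f y x ≤ N.toReal :=
    fun n m hn hnm hm => integral_triangle_le_toReal hn hnm hm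
      (g := fun x y => f y x)
      (cf.comp (f := Prod.swap) continuous_swap.continuousOn fun p hp => ⟨hp.2, hp.1⟩)
      (fun x y => sq_nonneg _) hNtop If'
  have hA_le : ∀ x ∈ Ioo 0 T, ∀ y ∈ Ioo 0 T,
      A (2 * x * y / (x + y)) / (x + y) ^ 2 ≤ M / (x + y) ^ 2 := fun x hx y hy =>
    div_le_div_of_nonneg_right ((le_abs_self _).trans
      (hAM _ (hIoo (harmonicMean_mem_Ioo hx hy))).1) (sq_nonneg _)
  have hA_ge : ∀ x ∈ Ioo 0 T, ∀ y ∈ Ioo 0 T,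
      c₀ / (x + y) ^ 2 ≤ A (2 * x * y / (x + y)) / (x + y) ^ 2 := fun x hx y hy =>
    div_le_div_of_nonneg_right (hcoer _ (Ioo_subset_Ico_self (hIoo' (harmonicMean_mem_Ioo hx hy))))
      (sq_nonneg _)
  have hD₁ : ∀ n m, 0 < n → n ≤ m → m < T →
      ∫ t in n..m, (deriv (fun a => W a t) t ^ 2 + deriv (W t) t ^ 2
        + 2 * (A (2 * t * t / (t + t)) / (t + t) ^ 2 * W t t ^ 2)) ≤ (7 + M) * N.toReal := by
    intro n m hn hnm hm
    have hsub : Icc n m ⊆ Ioo 0 T := fun t ht => ⟨hn.trans_le ht.1, ht.2.trans_lt hm⟩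
    have hd := lintegral_diag_le hT1 hM hdiag (q₂ := q₂) (fun t ht => hA_le t ht t ht)
    simp only [q₂, add_sub_cancel_left] at hd
    have diag : ∀ {g : ℝ → ℝ → ℝ},
        ContinuousOn (fun p : ℝ × ℝ => g p.1 p.2) (Ioo 0 T ×ˢ Ioo 0 T) →
        ContinuousOn (fun t => g t t) (Icc n m) := fun hg =>
      hg.comp (f := fun t => (t, t)) (by fun_prop) fun t ht => ⟨hsub ht, hsub ht⟩
    have cU := diag (g := fun x y => deriv (fun a => W a y) x) H.contU
    have cV := diag (g := fun x y => deriv (W x) y) H.contV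
    have cW := diag H.contW
    have ch := diag (g := fun x y => A (2 * x * y / (x + y)) / (x + y) ^ 2) H.conth
    have c : ContinuousOn (fun t => deriv (fun a => W a t) t ^ 2 + deriv (W t) t ^ 2
        + 2 * (A (2 * t * t / (t + t)) / (t + t) ^ 2 * W t t ^ 2)) (Icc n m) :=
      ((cU.pow 2).add (cV.pow 2)).add (continuousOn_const.mul (ch.mul (cW.pow 2)))
    have i := c.intervalIntegrable_of_Icc (μ := volume) hnm
    have key := (ofReal_intervalIntegral_le_lintegral hnm i (fun t ht => add_nonneg (by positivity)
      (mul_nonneg zero_le_two (mul_nonneg (H.h_nonneg t (hsub ht) t (hsub ht)) (sq_nonneg _))))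
      hsub).trans (hd.trans (mul_le_mul_right (le_self_add : _ ≤ N) _))
    rwa [ENNReal.ofReal_le_iff_le_toReal (ENNReal.mul_ne_top ENNReal.ofReal_ne_top hNtop),
      ENNReal.toReal_mul, ENNReal.toReal_ofReal (by positivity)] at key
  have hC : ENNReal.ofReal ((1 + (lam + 1) / c₀) * (4 * ((7 + M) * N.toReal + 2 * N.toReal)))
      = ENNReal.ofReal ((1 + (lam + 1) / c₀) * (4 * ((7 + M) + 2))) * N := by
    conv_rhs => rw [← ENNReal.ofReal_toReal hNtop]
    rw [← ENNReal.ofReal_mul (by positivity)]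
    congr 1
    ring
  have slice : ∀ {g : ℝ → ℝ → ℝ},
      ContinuousOn (fun p : ℝ × ℝ => g p.1 p.2) (Ioo 0 T ×ˢ Ioo 0 T) →
      ∀ x ∈ Ioo 0 T, ContinuousOn (fun y => g x y) (Ioo 0 T) := fun hg x hx =>
    hg.comp (f := fun y => (x, y)) (by fun_prop) fun y hy => ⟨hx, hy⟩
  refine ⟨fun x hx => ?_, fun x hx => ?_⟩
  · rw [← hC]
    exact lintegral_slice_le (h := fun y => A (2 * x * y / (x + y)) / (x + y) ^ 2)
      hc₀ (by positivity) hx (slice (g := fun x y => deriv (W x) y) H.contV x hx)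
      (slice H.contW x hx)
      (slice (g := fun x y => A (2 * x * y / (x + y)) / (x + y) ^ 2) H.conth x hx) (hA_ge x hx)
      fun n m hn hnx hxm hm => H.slice_bound hK hTK hD₁ hD₂ hD₂' hn hnx hxm hm
  · rw [← hC]
    have hD₁' : ∀ n m, 0 < n → n ≤ m → m < T →
        ∫ t in n..m, (deriv (W t) t ^ 2 + deriv (fun a => W a t) t ^ 2
          + 2 * (A (2 * t * t / (t + t)) / (t + t) ^ 2 * W t t ^ 2)) ≤ (7 + M) * N.toReal := by
      intro n m hn hnm hm
      simpa only [add_comm (deriv (W _) _ ^ 2)] using hD₁ n m hn hnm hm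
    simp only [add_comm _ x]
    exact lintegral_slice_le (h := fun y => A (2 * y * x / (y + x)) / (y + x) ^ 2)
      hc₀ (by positivity) hx (slice (g := fun x y => deriv (fun a => W a x) y) H.swap.contV x hx)
      (slice (g := fun x y => W y x) H.swap.contW x hx)
      (slice (g := fun x y => A (2 * y * x / (y + x)) / (y + x) ^ 2) H.swap.conth x hx)
      (fun y hy => by rw [add_comm x y]; exact hA_ge y hy x hx)
      fun n m hn hnx hxm hm => H.swap.slice_bound hK hTK hD₁' hD₂' hD₂ hn hnx hxm hm
end
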